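/- arXiv:math-ph/0309053 — 5 statements merged into one kernel-verified Lean document; each statement's English description precedes it below -/
import Mathlib

section
/- Ehrenfest's theorem for the generalized nonlinear Schrödinger equation (smooth setting): Let d ≥ 1, let V : ℝ^d → ℝ be C¹ with V and ∇V of at most polynomial growth, let h : [0,∞) → ℝ be continuous, and let ψ be a classical Schwartz-class solution of i∂_tψ = (−Δ + V)ψ − h(|ψ|²)ψ on ℝ × ℝ^d. Then for each j ∈ {1,…,d} the function t ↦ Im ∫_{ℝ^d} conj(ψ(t,x)) ∂_{x_j}ψ(t,x) dx is differentiable in t, and its derivative equals −∫_{ℝ^d} |ψ(t,x)|² ∂_{x_j}V(x) dx. -/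
open MeasureTheory

noncomputable section

/-- Spatial partial derivative in the `j`-th coordinate direction. -/
def pdC (d : ℕ) (j : Fin d) (f : EuclideanSpace ℝ (Fin d) → ℂ)
    (x : EuclideanSpace ℝ (Fin d)) : ℂ :=
  fderiv ℝ f x (EuclideanSpace.single j (1 : ℝ))

/-- Spatial Laplacian of a complex-valued function on `ℝ^d`. -/
def lapC (d : ℕ) (f : EuclideanSpace ℝ (Fin d) → ℂ) (x : EuclideanSpace ℝ (Fin d)) : ℂ :=
  ∑ j, pdC d j (fun y => pdC d j f y) x

section Decay

variable {E F G : Type*} [NormedAddCommGroup E] [NormedAddCommGroup F] [NormedAddCommGroup G]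

/-- Functions decaying faster than every inverse power of `1 + ‖x‖`. -/
def RapidDecay (g : E → F) : Prop :=
  ∀ k : ℕ, ∃ C : ℝ, ∀ x, (1 + ‖x‖) ^ k * ‖g x‖ ≤ C

theorem RapidDecay.of_norm_le_mul {f : E → F} {g : E → G} (hg : RapidDecay g) {C : ℝ} {n : ℕ}
    (hC : 0 ≤ C) (hf : ∀ x, ‖f x‖ ≤ C * (1 + ‖x‖) ^ n * ‖g x‖) : RapidDecay f := by
  intro k
  obtain ⟨D, hD⟩ := hg (k + n)
  refine ⟨C * D, fun x => ?_⟩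
  calc (1 + ‖x‖) ^ k * ‖f x‖ ≤ (1 + ‖x‖) ^ k * (C * (1 + ‖x‖) ^ n * ‖g x‖) := by
        gcongr; exact hf x
    _ = C * ((1 + ‖x‖) ^ (k + n) * ‖g x‖) := by ring
    _ ≤ C * D := by gcongr; exact hD x

theorem RapidDecay.add {f g : E → F} (hf : RapidDecay f) (hg : RapidDecay g) :
    RapidDecay (fun x => f x + g x) := by
  intro k
  obtain ⟨C, hC⟩ := hf k
  obtain ⟨D, hD⟩ := hg k
  refine ⟨C + D, fun x => ?_⟩
  calc (1 + ‖x‖) ^ k * ‖f x + g x‖ ≤ (1 + ‖x‖) ^ k * (‖f x‖ + ‖g x‖) := by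
        gcongr; exact norm_add_le _ _
    _ = (1 + ‖x‖) ^ k * ‖f x‖ + (1 + ‖x‖) ^ k * ‖g x‖ := by ring
    _ ≤ C + D := add_le_add (hC x) (hD x)

theorem RapidDecay.bounded {f : E → F} (hf : RapidDecay f) : ∃ C, 0 ≤ C ∧ ∀ x, ‖f x‖ ≤ C := by
  obtain ⟨C, hC⟩ := hf 0
  refine ⟨C, le_trans (by positivity) (hC 0), fun x => by simpa using hC x⟩

theorem RapidDecay.mul_growth {𝕜 : Type*} [NormedField 𝕜] {f g : E → 𝕜} (hg : RapidDecay g)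
    (hf : ∃ C : ℝ, ∃ n : ℕ, ∀ x, ‖f x‖ ≤ C * (1 + ‖x‖) ^ n) :
    RapidDecay (fun x => f x * g x) := by
  obtain ⟨C, n, hC⟩ := hf
  have hC0 : 0 ≤ C := by
    have := (norm_nonneg _).trans (hC 0)
    simpa using this
  refine hg.of_norm_le_mul (n := n) hC0 fun x => ?_
  rw [norm_mul]
  gcongr
  exact hC x

theorem RapidDecay.conj_mul {f g : E → ℂ} (hf : RapidDecay f) (hg : RapidDecay g) :
    RapidDecay (fun x => (starRingEnd ℂ) (f x) * g x) := by
  obtain ⟨C, -, hC⟩ := hf.bounded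
  exact hg.mul_growth ⟨C, 0, fun x => by simpa using hC x⟩

theorem RapidDecay.clm [NormedSpace ℝ F] [NormedSpace ℝ G] {f : E → F} (hf : RapidDecay f)
    (L : F →L[ℝ] G) : RapidDecay (fun x => L (f x)) :=
  hf.of_norm_le_mul (n := 0) (norm_nonneg L) fun x => by simpa using L.le_opNorm (f x)

theorem norm_le_of_decay_bound {f : F} {x : E} {C : ℝ} {n : ℕ} (h : (1 + ‖x‖) ^ n * ‖f‖ ≤ C) :
    ‖f‖ ≤ C * (1 + ‖x‖) ^ (-(n : ℝ)) := by
  have hx : 0 < 1 + ‖x‖ := by positivity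
  rw [Real.rpow_neg hx.le, Real.rpow_natCast, ← div_eq_mul_inv, le_div_iff₀ (by positivity)]
  linarith

variable [NormedSpace ℝ E] [FiniteDimensional ℝ E] [MeasurableSpace E] [BorelSpace E]

theorem integrable_of_decay_bound {μ : Measure E} [μ.IsAddHaarMeasure] (C : ℝ) :
    Integrable (fun x : E => C * (1 + ‖x‖) ^ (-((Module.finrank ℝ E + 1 : ℕ) : ℝ))) μ :=
  (integrable_one_add_norm (by push_cast; linarith)).const_mul C

theorem RapidDecay.integrable {μ : Measure E} [μ.IsAddHaarMeasure] {f : E → F}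
    (hf : RapidDecay f) (hc : Continuous f) : Integrable f μ := by
  obtain ⟨C, hC⟩ := hf (Module.finrank ℝ E + 1)
  exact (integrable_of_decay_bound C).mono' hc.aestronglyMeasurable
    (.of_forall fun x => norm_le_of_decay_bound (hC x))

theorem integral_eq_zero_of_hasLineDerivAt {μ : Measure E} [μ.IsAddHaarMeasure] {g g' : E → ℝ}
    {v : E} (hg : Integrable g μ) (hg' : Integrable g' μ)
    (hd : ∀ x, HasLineDerivAt ℝ g (g' x) x v) : ∫ x, g' x ∂μ = 0 := by
  have := integral_bilinear_hasLineDerivAt_right_eq_neg_left_of_integrable (μ := μ)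
    (f := fun _ : E => (1 : ℝ)) (f' := fun _ => 0) (g := g) (g' := g') (v := v)
    (B := ContinuousLinearMap.mul ℝ ℝ) (by simp) (by simpa using hg') (by simpa using hg)
    (fun x _ => hasDerivAt_const _ _) (fun x _ => hd x)
  simpa using this

end Decay

section Static

open SchwartzMap LineDeriv

variable {E : Type*} [NormedAddCommGroup E] [NormedSpace ℝ E]

theorem SchwartzMap.rapidDecay {F : Type*} [NormedAddCommGroup F] [NormedSpace ℝ F]
    (f : 𝓢(E, F)) : RapidDecay f := by
  intro k
  have h := SchwartzMap.one_add_le_sup_seminorm_apply (𝕜 := ℝ) (m := (k, 0)) le_rfl le_rfl f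
  simp only [norm_iteratedFDeriv_zero] at h
  exact ⟨_, h⟩

theorem SchwartzMap.hasLineDerivAt {F : Type*} [NormedAddCommGroup F] [NormedSpace ℝ F]
    (f : 𝓢(E, F)) (v x : E) : HasLineDerivAt ℝ f (∂_{v} f x) x v :=
  (f.hasFDerivAt x).hasLineDerivAt v

theorem SchwartzMap.lineDerivOp_symm {F : Type*} [NormedAddCommGroup F] [NormedSpace ℝ F]
    (f : 𝓢(E, F)) (v w x : E) : ∂_{v} (∂_{w} f) x = ∂_{w} (∂_{v} f) x := by
  have hd : DifferentiableAt ℝ (fderiv ℝ f) x :=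
    (f.smooth 2).contDiffAt.fderiv_right (m := 1) (by norm_num) |>.differentiableAt (by simp)
  have key (v w : E) : ∂_{v} (∂_{w} f) x = fderiv ℝ (fderiv ℝ f) x v w := by
    change fderiv ℝ (fun y => fderiv ℝ f y w) x v = _
    rw [fderiv_clm_apply hd (by fun_prop)]
    simp
  rw [key, key]
  exact (f.smooth 2).contDiffAt.isSymmSndFDerivAt (by simp) v w

theorem HasLineDerivAt.conj_mul {f g : E → ℂ} {f' g' : ℂ} {x v : E}
    (hf : HasLineDerivAt ℝ f f' x v) (hg : HasLineDerivAt ℝ g g' x v) :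
    HasLineDerivAt ℝ (fun y => (starRingEnd ℂ) (f y) * g y)
      ((starRingEnd ℂ) f' * g x + (starRingEnd ℂ) (f x) * g') x v := by
  have hf1 : HasDerivAt (fun t : ℝ => (starRingEnd ℂ) (f (x + t • v))) ((starRingEnd ℂ) f') 0 :=
    Complex.conjCLE.hasFDerivAt.comp_hasDerivAt (0 : ℝ) hf
  have h := HasDerivAt.mul hf1 hg
  simp only [zero_smul, add_zero] at h
  exact h

theorem HasLineDerivAt.normSq {f : E → ℂ} {f' : ℂ} {x v : E} (hf : HasLineDerivAt ℝ f f' x v) :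
    HasLineDerivAt ℝ (fun y => Complex.normSq (f y))
      (2 * ((starRingEnd ℂ) (f x) * f').re) x v := by
  have h1 : HasLineDerivAt ℝ (fun y => ((starRingEnd ℂ) (f y) * f y).re) _ x v :=
    Complex.reCLM.hasFDerivAt.comp_hasDerivAt (0 : ℝ) (hf.conj_mul hf)
  convert h1 using 1
  · ext y; simp [Complex.normSq_apply]
  · simp; ring

theorem SchwartzMap.rapidDecay_normSq (u : 𝓢(E, ℂ)) :
    RapidDecay (fun x => Complex.normSq (u x)) := by
  have := (u.rapidDecay.conj_mul u.rapidDecay).clm Complex.reCLM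
  convert this using 2 with x
  simp [Complex.normSq_apply]

variable [FiniteDimensional ℝ E] [MeasurableSpace E] [BorelSpace E]
  {μ : Measure E} [μ.IsAddHaarMeasure]

theorem SchwartzMap.integrable_clm_conj_mul (L : ℂ →L[ℝ] ℝ) (f g : 𝓢(E, ℂ)) :
    Integrable (fun x => L ((starRingEnd ℂ) (f x) * g x)) μ :=
  ((f.rapidDecay.conj_mul g.rapidDecay).clm L).integrable
    (L.continuous.comp ((Complex.continuous_conj.comp f.continuous).mul g.continuous))

theorem SchwartzMap.integrable_clm_lineDeriv_conj_mul (L : ℂ →L[ℝ] ℝ) (f g : 𝓢(E, ℂ)) (v : E) :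
    Integrable (fun x => L ((starRingEnd ℂ) (∂_{v} f x) * g x
      + (starRingEnd ℂ) (f x) * ∂_{v} g x)) μ := by
  simp only [map_add]
  exact (integrable_clm_conj_mul L _ _).add (integrable_clm_conj_mul L _ _)

theorem SchwartzMap.integral_clm_lineDeriv_conj_mul (L : ℂ →L[ℝ] ℝ) (f g : 𝓢(E, ℂ)) (v : E) :
    ∫ x, L ((starRingEnd ℂ) (∂_{v} f x) * g x
      + (starRingEnd ℂ) (f x) * ∂_{v} g x) ∂μ = 0 :=
  integral_eq_zero_of_hasLineDerivAt (integrable_clm_conj_mul L f g)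
    (integrable_clm_lineDeriv_conj_mul L f g v) fun x =>
      L.hasFDerivAt.comp_hasDerivAt (0 : ℝ) ((f.hasLineDerivAt v x).conj_mul (g.hasLineDerivAt v x))

/-- A pure second derivative of `u` is orthogonal, in the real `L²` inner product, to
every first derivative of `u`. -/
theorem SchwartzMap.integral_re_conj_second_lineDeriv_mul (u : 𝓢(E, ℂ)) (v w : E) :
    ∫ x, ((starRingEnd ℂ) (∂_{w} (∂_{w} u) x) * ∂_{v} u x).re ∂μ = 0 := by
  have h1 := integral_clm_lineDeriv_conj_mul (μ := μ) Complex.reCLM (∂_{w} u) (∂_{v} u) w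
  have h2 := integral_clm_lineDeriv_conj_mul (μ := μ) Complex.reCLM (∂_{w} u) (∂_{w} u) v
  have h3 : ∀ x, ((starRingEnd ℂ) (∂_{w} (∂_{w} u) x) * ∂_{v} u x).re =
      Complex.reCLM ((starRingEnd ℂ) (∂_{w} (∂_{w} u) x) * ∂_{v} u x
        + (starRingEnd ℂ) (∂_{w} u x) * ∂_{w} (∂_{v} u) x) -
      2⁻¹ * Complex.reCLM ((starRingEnd ℂ) (∂_{v} (∂_{w} u) x) * ∂_{w} u x
        + (starRingEnd ℂ) (∂_{w} u x) * ∂_{v} (∂_{w} u) x) := by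
    intro x
    rw [u.lineDerivOp_symm w v x]
    simp
    ring
  simp_rw [h3]
  rw [integral_sub (integrable_clm_lineDeriv_conj_mul _ _ _ _)
    ((integrable_clm_lineDeriv_conj_mul _ _ _ _).const_mul _), integral_const_mul, h1, h2]
  simp

/-- For a potential of polynomial growth, `∂ᵥ(V|u|²)` is integrable with integral zero. -/
theorem SchwartzMap.integral_lineDeriv_mul_normSq {V : E → ℝ} (hV : ContDiff ℝ 1 V)
    (hVpoly : ∃ C : ℝ, ∃ n : ℕ, ∀ x, |V x| ≤ C * (1 + ‖x‖) ^ n)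
    (hVgradpoly : ∃ C : ℝ, ∃ n : ℕ, ∀ x, ‖fderiv ℝ V x‖ ≤ C * (1 + ‖x‖) ^ n)
    (u : 𝓢(E, ℂ)) (v : E) :
    Integrable (fun x => Complex.normSq (u x) * fderiv ℝ V x v) μ ∧
    Integrable (fun x => V x * (2 * ((starRingEnd ℂ) (u x) * ∂_{v} u x).re)) μ ∧
    ∫ x, V x * (2 * ((starRingEnd ℂ) (u x) * ∂_{v} u x).re) ∂μ =
      -∫ x, Complex.normSq (u x) * fderiv ℝ V x v ∂μ := by
  have hcu : Continuous fun x => Complex.normSq (u x) :=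
    Complex.continuous_normSq.comp u.continuous
  have hg : ∃ C : ℝ, ∃ n : ℕ, ∀ x, ‖fderiv ℝ V x v‖ ≤ C * (1 + ‖x‖) ^ n := by
    obtain ⟨C, n, hC⟩ := hVgradpoly
    refine ⟨C * ‖v‖, n, fun x => ((fderiv ℝ V x).le_opNorm v).trans ?_⟩
    calc _ ≤ C * (1 + ‖x‖) ^ n * ‖v‖ := by gcongr; exact hC x
      _ = _ := by ring
  have i1 : Integrable (fun x => Complex.normSq (u x) * fderiv ℝ V x v) μ := by
    simp_rw [mul_comm (Complex.normSq _)]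
    exact (u.rapidDecay_normSq.mul_growth hg).integrable
      (((hV.continuous_fderiv (by simp)).clm_apply continuous_const).mul hcu)
  have hc : Continuous fun x => 2 * ((starRingEnd ℂ) (u x) * ∂_{v} u x).re :=
    continuous_const.mul (Complex.continuous_re.comp
      ((Complex.continuous_conj.comp u.continuous).mul (∂_{v} u).continuous))
  have hr : RapidDecay fun x => 2 * ((starRingEnd ℂ) (u x) * ∂_{v} u x).re :=
    (u.rapidDecay.conj_mul (∂_{v} u).rapidDecay).clm ((2 : ℝ) • Complex.reCLM)
  have i2 : Integrable (fun x => V x * (2 * ((starRingEnd ℂ) (u x) * ∂_{v} u x).re)) μ :=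
    (hr.mul_growth hVpoly).integrable (hV.continuous.mul hc)
  have i3 : Integrable (fun x => V x * Complex.normSq (u x)) μ :=
    (u.rapidDecay_normSq.mul_growth hVpoly).integrable (hV.continuous.mul hcu)
  refine ⟨i1, i2, ?_⟩
  have key := integral_eq_zero_of_hasLineDerivAt (v := v) i3 (i1.add i2) fun x => by
    have hV1 : HasLineDerivAt ℝ V (fderiv ℝ V x v) x v :=
      (hV.differentiable (by simp) x).hasFDerivAt.hasLineDerivAt v
    have := HasDerivAt.mul hV1 (u.hasLineDerivAt v x).normSq
    simp only [zero_smul, add_zero] at this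
    rw [mul_comm (fderiv ℝ V x v)] at this
    exact this
  simp only [Pi.add_apply] at key
  rw [integral_add i1 i2] at key
  linarith

/-- A local nonlinearity exerts no net force: `h(|u|²) ∂ᵥ|u|²` has integral zero. -/
theorem SchwartzMap.integral_comp_normSq_mul_lineDeriv {h : ℝ → ℝ}
    (hh : ContinuousOn h (Set.Ici 0)) (u : 𝓢(E, ℂ)) (v : E) :
    Integrable (fun x => h (Complex.normSq (u x)) *
      (2 * ((starRingEnd ℂ) (u x) * ∂_{v} u x).re)) μ ∧
    ∫ x, h (Complex.normSq (u x)) * (2 * ((starRingEnd ℂ) (u x) * ∂_{v} u x).re) ∂μ = 0 := by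
  set H : ℝ → ℝ := fun s => h (max s 0) with hH
  have hHc : Continuous H := hh.comp_continuous (by fun_prop) fun s => le_max_right s 0
  have hHh (x : E) : h (Complex.normSq (u x)) = H (Complex.normSq (u x)) := by
    simp [hH, Complex.normSq_nonneg]
  simp_rw [hHh]
  have hcu : Continuous fun x => Complex.normSq (u x) :=
    Complex.continuous_normSq.comp u.continuous
  obtain ⟨R, hR0, hR⟩ := u.rapidDecay_normSq.bounded
  obtain ⟨M, hM⟩ := (isCompact_Icc (a := 0) (b := R)).exists_bound_of_continuousOn
    hHc.continuousOn
  have hM0 : 0 ≤ M := (norm_nonneg _).trans (hM 0 ⟨le_rfl, hR0⟩)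
  have hu (x : E) : Complex.normSq (u x) ≤ R := (le_abs_self _).trans (hR x)
  have hc : Continuous fun x => 2 * ((starRingEnd ℂ) (u x) * ∂_{v} u x).re :=
    continuous_const.mul (Complex.continuous_re.comp
      ((Complex.continuous_conj.comp u.continuous).mul (∂_{v} u).continuous))
  have hr : RapidDecay fun x => 2 * ((starRingEnd ℂ) (u x) * ∂_{v} u x).re :=
    (u.rapidDecay.conj_mul (∂_{v} u).rapidDecay).clm ((2 : ℝ) • Complex.reCLM)
  have i1 : Integrable (fun x => H (Complex.normSq (u x)) *
      (2 * ((starRingEnd ℂ) (u x) * ∂_{v} u x).re)) μ :=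
    (hr.mul_growth ⟨M, 0, fun x => by
      simpa using hM _ ⟨Complex.normSq_nonneg _, hu x⟩⟩).integrable ((hHc.comp hcu).mul hc)
  have hder (s : ℝ) : HasDerivAt (fun y => ∫ r in (0 : ℝ)..y, H r) (H s) s :=
    (hHc.integral_hasStrictDerivAt 0 s).hasDerivAt
  have hPc : Continuous fun y => ∫ r in (0 : ℝ)..y, H r :=
    continuous_iff_continuousAt.2 fun s => (hder s).continuousAt
  have i2 : Integrable (fun x => ∫ r in (0 : ℝ)..Complex.normSq (u x), H r) μ := by
    refine (u.rapidDecay_normSq.of_norm_le_mul (n := 0) hM0 fun x => ?_).integrable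
      (hPc.comp hcu)
    have := intervalIntegral.norm_integral_le_of_norm_le_const (a := 0)
      (b := Complex.normSq (u x)) (f := H) (C := M) fun r hr => by
        rw [Set.uIoc_of_le (Complex.normSq_nonneg _)] at hr
        exact hM r ⟨hr.1.le, hr.2.trans (hu x)⟩
    simpa using this
  refine ⟨i1, integral_eq_zero_of_hasLineDerivAt (v := v) i2 i1 fun x => ?_⟩
  have h1 := (u.hasLineDerivAt v x).normSq
  exact HasDerivAt.comp (0 : ℝ) (by simpa using hder (Complex.normSq (u x))) h1

/-- The force balance at a fixed time: `w` plays the role of `∂ₜu`. -/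
theorem SchwartzMap.integral_im_momentum_deriv {ι : Type*} [Fintype ι] (b : ι → E)
    {V : E → ℝ} (hV : ContDiff ℝ 1 V)
    (hVpoly : ∃ C : ℝ, ∃ n : ℕ, ∀ x, |V x| ≤ C * (1 + ‖x‖) ^ n)
    (hVgradpoly : ∃ C : ℝ, ∃ n : ℕ, ∀ x, ‖fderiv ℝ V x‖ ≤ C * (1 + ‖x‖) ^ n)
    {h : ℝ → ℝ} (hh : ContinuousOn h (Set.Ici 0)) (u w : 𝓢(E, ℂ))
    (heq : ∀ x, Complex.I * w x = -(∑ k, ∂_{b k} (∂_{b k} u) x) + (V x : ℂ) * u x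
      - (h (Complex.normSq (u x)) : ℂ) * u x) (v : E) :
    ∫ x, ((starRingEnd ℂ) (w x) * ∂_{v} u x + (starRingEnd ℂ) (u x) * ∂_{v} w x).im ∂μ =
      -∫ x, Complex.normSq (u x) * fderiv ℝ V x v ∂μ := by
  obtain ⟨-, iV, eV⟩ := integral_lineDeriv_mul_normSq (μ := μ) hV hVpoly hVgradpoly u v
  obtain ⟨ih, eh⟩ := integral_comp_normSq_mul_lineDeriv (μ := μ) hh u v
  have i1 := integrable_clm_lineDeriv_conj_mul (μ := μ) Complex.imCLM u w v
  have e1 := integral_clm_lineDeriv_conj_mul (μ := μ) Complex.imCLM u w v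
  have iL (k : ι) : Integrable
      (fun x => ((starRingEnd ℂ) (∂_{b k} (∂_{b k} u) x) * ∂_{v} u x).re) μ :=
    integrable_clm_conj_mul Complex.reCLM _ _
  have iL' := (integrable_finsetSum Finset.univ fun k _ => iL k).const_mul 2
  have eL : ∫ x, 2 * ∑ k, ((starRingEnd ℂ) (∂_{b k} (∂_{b k} u) x) * ∂_{v} u x).re ∂μ = 0 := by
    rw [integral_const_mul, integral_finsetSum _ fun k _ => iL k]
    simp only [integral_re_conj_second_lineDeriv_mul, Finset.sum_const_zero, mul_zero]
  have key (x : E) :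
      ((starRingEnd ℂ) (w x) * ∂_{v} u x + (starRingEnd ℂ) (u x) * ∂_{v} w x).im =
      Complex.imCLM ((starRingEnd ℂ) (∂_{v} u x) * w x + (starRingEnd ℂ) (u x) * ∂_{v} w x)
      - 2 * ∑ k, ((starRingEnd ℂ) (∂_{b k} (∂_{b k} u) x) * ∂_{v} u x).re
      + V x * (2 * ((starRingEnd ℂ) (u x) * ∂_{v} u x).re)
      - h (Complex.normSq (u x)) * (2 * ((starRingEnd ℂ) (u x) * ∂_{v} u x).re) := by
    have hs : ∑ k, ((starRingEnd ℂ) (∂_{b k} (∂_{b k} u) x) * ∂_{v} u x).re =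
        ((starRingEnd ℂ) (∑ k, ∂_{b k} (∂_{b k} u) x) * ∂_{v} u x).re := by
      rw [map_sum, Finset.sum_mul, Complex.re_sum]
    have hre := congrArg Complex.re (heq x)
    have him := congrArg Complex.im (heq x)
    rw [hs]
    generalize ∑ k, ∂_{b k} (∂_{b k} u) x = L at *
    simp at hre him ⊢
    linear_combination 2 * (∂_{v} u x).re * hre + 2 * (∂_{v} u x).im * him
  simp_rw [key]
  have i2 := i1.sub iL'
  have i3 := i2.add iV
  simp only [Pi.sub_def, Pi.add_def] at i2 i3
  rw [integral_sub i3 ih, integral_add i2 iV, integral_sub i1 iL', e1, eL, eV, eh]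
  ring

end Static

section TimeDerivative

variable {E : Type*} [NormedAddCommGroup E] [NormedSpace ℝ E] {ψ : ℝ → E → ℂ}

theorem ContDiff.hasDerivAt_fst_of_uncurry (hψ : ContDiff ℝ (⊤ : ℕ∞) (Function.uncurry ψ))
    (t : ℝ) (x : E) :
    HasDerivAt (fun τ => ψ τ x) (fderiv ℝ (Function.uncurry ψ) (t, x) (1, 0)) t :=
  HasFDerivAt.comp_hasDerivAt t (f := fun τ : ℝ => (τ, x))
    (hψ.differentiable (by simp) (t, x)).hasFDerivAt
    ((hasDerivAt_id t).prodMk (hasDerivAt_const t x))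

theorem ContDiff.fderiv_snd_eq_fderiv_uncurry (hψ : ContDiff ℝ (⊤ : ℕ∞) (Function.uncurry ψ))
    (t : ℝ) (x v : E) :
    fderiv ℝ (ψ t) x v = fderiv ℝ (Function.uncurry ψ) (t, x) (0, v) := by
  have h1 : HasFDerivAt (ψ t) _ x := HasFDerivAt.comp x (f := fun y : E => (t, y))
    (hψ.differentiable (by simp) (t, x)).hasFDerivAt (hasFDerivAt_prodMk_right t x)
  rw [h1.fderiv]
  simp

theorem ContDiff.contDiff_deriv_fst (hψ : ContDiff ℝ (⊤ : ℕ∞) (Function.uncurry ψ)) (t : ℝ) :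
    ContDiff ℝ (⊤ : ℕ∞) (fun x => deriv (fun τ => ψ τ x) t) := by
  simp_rw [fun x => (hψ.hasDerivAt_fst_of_uncurry t x).deriv]
  have h1 : ContDiff ℝ (⊤ : ℕ∞) (fderiv ℝ (Function.uncurry ψ)) :=
    hψ.fderiv_right (by simp)
  exact (h1.comp (contDiff_prodMk_right t)).clm_apply contDiff_const

/-- Time and space derivatives of a smooth function commute. -/
theorem ContDiff.hasDerivAt_fderiv_snd (hψ : ContDiff ℝ (⊤ : ℕ∞) (Function.uncurry ψ))
    (t : ℝ) (x v : E) :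
    HasDerivAt (fun τ => fderiv ℝ (ψ τ) x v)
      (fderiv ℝ (fun y => deriv (fun τ => ψ τ y) t) x v) t := by
  have h1 : ContDiff ℝ (⊤ : ℕ∞) (fderiv ℝ (Function.uncurry ψ)) :=
    hψ.fderiv_right (by simp)
  have h2 := (h1.differentiable (by simp) (t, x)).hasFDerivAt
  simp_rw [fun y => (hψ.hasDerivAt_fst_of_uncurry t y).deriv,
    fun τ => hψ.fderiv_snd_eq_fderiv_uncurry τ x v]
  have h3 : HasFDerivAt (fun y => fderiv ℝ (Function.uncurry ψ) (t, y) (1, 0)) _ x :=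
    (HasFDerivAt.comp x (f := fun y : E => (t, y)) h2 (hasFDerivAt_prodMk_right t x)).clm_apply
      (hasFDerivAt_const _ _)
  have h4 : HasDerivAt (fun τ => fderiv ℝ (Function.uncurry ψ) (τ, x) (0, v)) _ t :=
    (HasFDerivAt.comp_hasDerivAt t (f := fun τ : ℝ => (τ, x)) h2
      ((hasDerivAt_id t).prodMk (hasDerivAt_const t x))).clm_apply (hasDerivAt_const _ _)
  rw [h3.fderiv]
  convert h4 using 1
  have := (contDiff_infty.1 hψ 2).contDiffAt.isSymmSndFDerivAt
    (x := (t, x)) (by simp) (0, v) (1, 0)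
  simpa using this

/-- Smooth functions with rapidly decreasing derivatives, as Schwartz maps. -/
def schwartzOfDecay (f : E → ℂ) (hf : ContDiff ℝ (⊤ : ℕ∞) f)
    (hd : ∀ n k : ℕ, ∃ C : ℝ, ∀ x, (1 + ‖x‖) ^ k * ‖iteratedFDeriv ℝ n f x‖ ≤ C) :
    SchwartzMap E ℂ where
  toFun := f
  smooth' := hf
  decay' k n := by
    obtain ⟨C, hC⟩ := hd n k
    refine ⟨C, fun x => le_trans ?_ (hC x)⟩
    gcongr
    linarith

variable [FiniteDimensional ℝ E] [MeasurableSpace E] [BorelSpace E]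
  {μ : Measure E} [μ.IsAddHaarMeasure]

theorem hasDerivAt_integral_conj_mul_fderiv
    (hψ : ContDiff ℝ (⊤ : ℕ∞) (Function.uncurry ψ))
    (hdecay0 : ∀ J : Set ℝ, IsCompact J → ∀ n k : ℕ, ∃ C : ℝ,
      ∀ t ∈ J, ∀ x, (1 + ‖x‖) ^ k * ‖iteratedFDeriv ℝ n (ψ t) x‖ ≤ C)
    (hdecay1 : ∀ J : Set ℝ, IsCompact J → ∀ n k : ℕ, ∃ C : ℝ,
      ∀ t ∈ J, ∀ x, (1 + ‖x‖) ^ k *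
        ‖iteratedFDeriv ℝ n (fun y => deriv (fun τ => ψ τ y) t) x‖ ≤ C)
    (v : E) (t : ℝ) :
    Integrable (fun x => (starRingEnd ℂ) (deriv (fun τ => ψ τ x) t) * fderiv ℝ (ψ t) x v
      + (starRingEnd ℂ) (ψ t x) * fderiv ℝ (fun y => deriv (fun τ => ψ τ y) t) x v) μ ∧
    HasDerivAt (fun τ => ∫ x, (starRingEnd ℂ) (ψ τ x) * fderiv ℝ (ψ τ) x v ∂μ)
      (∫ x, ((starRingEnd ℂ) (deriv (fun τ => ψ τ x) t) * fderiv ℝ (ψ t) x v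
        + (starRingEnd ℂ) (ψ t x) * fderiv ℝ (fun y => deriv (fun τ => ψ τ y) t) x v) ∂μ) t := by
  have hJ := isCompact_closedBall t 1
  set N := Module.finrank ℝ E + 1
  obtain ⟨C1, hC1⟩ := hdecay0 _ hJ 0 0
  obtain ⟨C2, hC2⟩ := hdecay0 _ hJ 1 N
  obtain ⟨C3, hC3⟩ := hdecay1 _ hJ 0 0
  obtain ⟨C4, hC4⟩ := hdecay1 _ hJ 1 N
  simp only [pow_zero, one_mul, norm_iteratedFDeriv_zero] at hC1 hC3
  simp only [norm_iteratedFDeriv_one] at hC2 hC4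
  have hψs (τ : ℝ) : ContDiff ℝ (⊤ : ℕ∞) (ψ τ) := hψ.comp (contDiff_prodMk_right τ)
  have hFc (τ : ℝ) : Continuous fun x => (starRingEnd ℂ) (ψ τ x) * fderiv ℝ (ψ τ) x v :=
    (Complex.continuous_conj.comp (hψs τ).continuous).mul
      (((hψs τ).continuous_fderiv (by simp)).clm_apply continuous_const)
  have hF'c : Continuous fun x => (starRingEnd ℂ) (deriv (fun τ => ψ τ x) t) * fderiv ℝ (ψ t) x v
      + (starRingEnd ℂ) (ψ t x) * fderiv ℝ (fun y => deriv (fun τ => ψ τ y) t) x v :=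
    ((Complex.continuous_conj.comp (hψ.contDiff_deriv_fst t).continuous).mul
      (((hψs t).continuous_fderiv (by simp)).clm_apply continuous_const)).add
    ((Complex.continuous_conj.comp (hψs t).continuous).mul
      (((hψ.contDiff_deriv_fst t).continuous_fderiv (by simp)).clm_apply continuous_const))
  have hmul {a b c A B : ℝ} (hb : 0 ≤ b) (hc : 0 ≤ c) (ha0 : 0 ≤ a) (ha : a ≤ A)
      (hcb : c * b ≤ B) : c * (a * (b * ‖v‖)) ≤ A * (B * ‖v‖) := by
    calc c * (a * (b * ‖v‖)) = a * ((c * b) * ‖v‖) := by ring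
      _ ≤ A * (B * ‖v‖) := by gcongr; exact ha0.trans ha
  have ht : t ∈ Metric.closedBall t 1 := Metric.mem_closedBall_self zero_le_one
  have hint : Integrable (fun x => (starRingEnd ℂ) (ψ t x) * fderiv ℝ (ψ t) x v) μ := by
    refine (integrable_of_decay_bound (C1 * (C2 * ‖v‖))).mono' (hFc t).aestronglyMeasurable
      (.of_forall fun x => norm_le_of_decay_bound ?_)
    rw [norm_mul, RCLike.norm_conj]
    refine le_trans ?_ (hmul (norm_nonneg (fderiv ℝ (ψ t) x)) (by positivity)
      (norm_nonneg _) (hC1 t ht x) (hC2 t ht x))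
    gcongr
    exact ContinuousLinearMap.le_opNorm _ _
  refine hasDerivAt_integral_of_dominated_loc_of_deriv_le
    (F := fun τ x => (starRingEnd ℂ) (ψ τ x) * fderiv ℝ (ψ τ) x v)
    (F' := fun s x => (starRingEnd ℂ) (deriv (fun τ => ψ τ x) s) * fderiv ℝ (ψ s) x v
      + (starRingEnd ℂ) (ψ s x) * fderiv ℝ (fun y => deriv (fun τ => ψ τ y) s) x v)
    (Metric.closedBall_mem_nhds t one_pos)
    (.of_forall fun τ => (hFc τ).aestronglyMeasurable) hint hF'c.aestronglyMeasurable
    (.of_forall fun x s hs => ?_)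
    (integrable_of_decay_bound (C3 * (C2 * ‖v‖) + C1 * (C4 * ‖v‖)))
    (.of_forall fun x s _ => ?_)
  · refine norm_le_of_decay_bound ?_
    refine (mul_le_mul_of_nonneg_left (norm_add_le _ _) (by positivity)).trans ?_
    rw [mul_add, norm_mul, norm_mul, RCLike.norm_conj, RCLike.norm_conj]
    refine add_le_add ?_ ?_
    · refine le_trans ?_ (hmul (norm_nonneg (fderiv ℝ (ψ s) x)) (by positivity)
        (norm_nonneg _) (hC3 s hs x) (hC2 s hs x))
      gcongr
      exact ContinuousLinearMap.le_opNorm _ _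
    · refine le_trans ?_ (hmul (norm_nonneg (fderiv ℝ (fun y => deriv (fun τ => ψ τ y) s) x))
        (by positivity) (norm_nonneg _) (hC1 s hs x) (hC4 s hs x))
      gcongr
      exact ContinuousLinearMap.le_opNorm _ _
  · have h1 := hψ.hasDerivAt_fst_of_uncurry s x
    have h2 : HasDerivAt (fun τ => (starRingEnd ℂ) (ψ τ x))
        ((starRingEnd ℂ) (deriv (fun τ => ψ τ x) s)) s :=
      Complex.conjCLE.hasFDerivAt.comp_hasDerivAt s h1.differentiableAt.hasDerivAt
    exact h2.mul (hψ.hasDerivAt_fderiv_snd s x v)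

end TimeDerivative

/-- Ehrenfest's theorem for the generalized nonlinear Schrödinger equation (smooth
setting): for a classical Schwartz-class solution `ψ` of
`i∂_tψ = (-Δ + V)ψ - h(|ψ|²)ψ`, with `V` C¹ of polynomial growth together with its
gradient, the map `t ↦ Im ∫ conj(ψ)∂_{x_j}ψ` is differentiable with derivative
`-∫ |ψ|² ∂_{x_j}V`. -/
theorem ehrenfest_theorem
    (d : ℕ) (hd : 1 ≤ d)
    (V : EuclideanSpace ℝ (Fin d) → ℝ) (hV : ContDiff ℝ 1 V)
    (hVpoly : ∃ C : ℝ, ∃ n : ℕ, ∀ x, |V x| ≤ C * (1 + ‖x‖) ^ n)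
    (hVgradpoly : ∃ C : ℝ, ∃ n : ℕ, ∀ x, ‖fderiv ℝ V x‖ ≤ C * (1 + ‖x‖) ^ n)
    (h : ℝ → ℝ) (hh : ContinuousOn h (Set.Ici 0))
    (ψ : ℝ → EuclideanSpace ℝ (Fin d) → ℂ)
    (hψ : ContDiff ℝ (⊤ : ℕ∞) (Function.uncurry ψ))
    (heq : ∀ t x, Complex.I * deriv (fun τ => ψ τ x) t =
      -(lapC d (ψ t) x) + (V x : ℂ) * ψ t x - (h (Complex.normSq (ψ t x)) : ℂ) * ψ t x)
    (hdecay0 : ∀ J : Set ℝ, IsCompact J → ∀ n k : ℕ, ∃ C : ℝ,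
      ∀ t ∈ J, ∀ x, (1 + ‖x‖) ^ k * ‖iteratedFDeriv ℝ n (ψ t) x‖ ≤ C)
    (hdecay1 : ∀ J : Set ℝ, IsCompact J → ∀ n k : ℕ, ∃ C : ℝ,
      ∀ t ∈ J, ∀ x, (1 + ‖x‖) ^ k *
        ‖iteratedFDeriv ℝ n (fun y => deriv (fun τ => ψ τ y) t) x‖ ≤ C)
    (j : Fin d) :
    ∀ t : ℝ, HasDerivAt
      (fun τ => (∫ x : EuclideanSpace ℝ (Fin d),
        (starRingEnd ℂ) (ψ τ x) * pdC d j (ψ τ) x).im)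
      (-∫ x : EuclideanSpace ℝ (Fin d),
        Complex.normSq (ψ t x) * fderiv ℝ V x (EuclideanSpace.single j (1 : ℝ))) t := by
  intro t
  have hdu := fun n k => (hdecay0 {t} isCompact_singleton n k).imp fun C hC => hC t rfl
  have hdw := fun n k => (hdecay1 {t} isCompact_singleton n k).imp fun C hC => hC t rfl
  let u := schwartzOfDecay (ψ t) (hψ.comp (contDiff_prodMk_right t)) hdu
  let w := schwartzOfDecay _ (hψ.contDiff_deriv_fst t) hdw
  obtain ⟨hint, hder⟩ := hasDerivAt_integral_conj_mul_fderiv (μ := volume) hψ hdecay0 hdecay1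
    (EuclideanSpace.single j (1 : ℝ)) t
  have hst := SchwartzMap.integral_im_momentum_deriv (μ := volume)
    (fun k : Fin d => EuclideanSpace.single k (1 : ℝ)) hV hVpoly hVgradpoly hh u w
    (heq t) (EuclideanSpace.single j (1 : ℝ))
  have him := Complex.imCLM.hasFDerivAt.comp_hasDerivAt t hder
  rw [← Complex.imCLM.integral_comp_comm hint] at him
  exact him.congr_deriv hst
end
end

section
/- Equation of motion in the moving frame (power nonlinearity): Let d ≥ 1, s > 0, λ ∈ ℝ, let V : ℝ^d → ℝ be differentiable, let a, v : ℝ → ℝ^d and γ : ℝ → ℝ be differentiable, let μ : ℝ → ℝ be any function, and let ψ : ℝ × ℝ^d → ℂ be smooth and satisfy i∂_tψ = (−Δ + V)ψ − λ|ψ|^{2s}ψ pointwise. Define u(t,x) := exp(−i((1/2)v(t)·x + γ(t))) ψ(t, x + a(t)). Then for all (t,x): ∂_t u = −i( −Δu + μ(t)u − λ|u|^{2s}u ) + (ȧ(t) − v(t))·∇u − i( (1/2)v̇(t) + ∇V(a(t)) )·x u + i( μ(t) − (1/4)|v(t)|² + (1/2)ȧ(t)·v(t) − V(a(t)) − γ̇(t)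 ) u − i R_V(t,x) u, where R_V(t,x) := V(x + a(t)) − V(a(t)) − ∇V(a(t))·x. -/
noncomputable section

/-- The moving-frame transform `u(t,x) = exp(-i((1/2)v(t)·x + γ(t)))ψ(t, x + a(t))`. -/
def mvFrame (d : ℕ) (a v : ℝ → EuclideanSpace ℝ (Fin d)) (γ : ℝ → ℝ)
    (ψ : ℝ → EuclideanSpace ℝ (Fin d) → ℂ) (t : ℝ) (x : EuclideanSpace ℝ (Fin d)) : ℂ :=
  Complex.exp (-Complex.I * (((1 / 2) * ∑ j, (v t) j * x j + γ t : ℝ) : ℂ)) * ψ t (x + a t)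

/-- The gauge phase `exp(-i((1/2)w·x + c))`. -/
def gaugePhase (d : ℕ) (w : EuclideanSpace ℝ (Fin d)) (c : ℝ)
    (x : EuclideanSpace ℝ (Fin d)) : ℂ :=
  Complex.exp (-Complex.I * (((1 / 2) * ∑ j, w j * x j + c : ℝ) : ℂ))

lemma norm_gaugePhase (d : ℕ) (w : EuclideanSpace ℝ (Fin d)) (c : ℝ)
    (x : EuclideanSpace ℝ (Fin d)) : ‖gaugePhase d w c x‖ = 1 := by
  rw [gaugePhase, Complex.norm_exp]
  simp only [Complex.mul_re, Complex.neg_re, Complex.neg_im, Complex.I_re, Complex.I_im,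
    Complex.ofReal_re, Complex.ofReal_im]
  simp

lemma continuousLinearMap_apply_eq_sum {F : Type*} [NormedAddCommGroup F] [NormedSpace ℝ F]
    {d : ℕ} (L : EuclideanSpace ℝ (Fin d) →L[ℝ] F) (x : EuclideanSpace ℝ (Fin d)) :
    L x = ∑ j, x j • L (EuclideanSpace.single j (1 : ℝ)) := by
  conv_lhs => rw [← (EuclideanSpace.basisFun (Fin d) ℝ).sum_repr x]
  simp

/-- Differentiating along a line turns the coordinate derivative into a one-variable one. -/
lemma hasDerivAt_line {d : ℕ} {f : EuclideanSpace ℝ (Fin d) → ℂ} (j : Fin d)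
    (x : EuclideanSpace ℝ (Fin d)) (hf : DifferentiableAt ℝ f x) :
    HasDerivAt (fun r : ℝ => f (x + r • EuclideanSpace.single j (1 : ℝ))) (pdC d j f x) 0 :=
  hf.hasFDerivAt.hasLineDerivAt _

lemma differentiable_gaugePhase (d : ℕ) (w : EuclideanSpace ℝ (Fin d)) (c : ℝ) :
    Differentiable ℝ (gaugePhase d w c) := by
  have h : Differentiable ℝ fun x : EuclideanSpace ℝ (Fin d) =>
      (1 / 2) * ∑ j, w j * x j + c := by fun_prop
  exact ((Complex.ofRealCLM.differentiable.comp h).const_mul (-Complex.I)).cexp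

lemma pdC_gaugePhase (d : ℕ) (w : EuclideanSpace ℝ (Fin d)) (c : ℝ) (j : Fin d)
    (x : EuclideanSpace ℝ (Fin d)) :
    pdC d j (gaugePhase d w c) x = gaugePhase d w c x * (-Complex.I * ((w j / 2 : ℝ) : ℂ)) := by
  refine (hasDerivAt_line j x (differentiable_gaugePhase d w c x)).unique ?_
  have h : HasDerivAt (fun r : ℝ => (1 / 2) *
      ∑ k, w k * (x + r • EuclideanSpace.single j (1 : ℝ)) k + c) (w j / 2) 0 := by
    have e : (fun r : ℝ => (1 / 2) *
        ∑ k, w k * (x + r • EuclideanSpace.single j (1 : ℝ)) k + c) =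
        fun r => r * (w j / 2) + ((1 / 2) * ∑ k, w k * x k + c) := by
      funext r
      simp [mul_add, Finset.sum_add_distrib]
      ring
    rw [e]
    simpa using ((hasDerivAt_id (0 : ℝ)).mul_const (w j / 2)).add_const
      ((1 / 2) * ∑ k, w k * x k + c)
  simpa [gaugePhase] using (h.ofReal_comp.const_mul (-Complex.I)).cexp

lemma pdC_gaugePhase_mul (d : ℕ) (w b : EuclideanSpace ℝ (Fin d)) (c : ℝ) (j : Fin d)
    {f : EuclideanSpace ℝ (Fin d) → ℂ} (hf : Differentiable ℝ f)
    (x : EuclideanSpace ℝ (Fin d)) :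
    pdC d j (fun y => gaugePhase d w c y * f (y + b)) x =
      gaugePhase d w c x * (pdC d j f (x + b) - Complex.I * ((w j / 2 : ℝ) : ℂ) * f (x + b)) := by
  have h1 := (differentiable_gaugePhase d w c x).hasFDerivAt
  have h2 := (hf (x + b)).hasFDerivAt.comp x ((hasFDerivAt_id x).add_const b)
  have h3 := pdC_gaugePhase d w c j x
  have h4 := (h1.mul h2).fderiv
  simp only [pdC, Function.comp_def, id] at h3 h4 ⊢
  erw [h4]
  simp [h3]
  ring

lemma differentiable_pdC {d : ℕ} {f : EuclideanSpace ℝ (Fin d) → ℂ} (hf : ContDiff ℝ 2 f)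
    (j : Fin d) : Differentiable ℝ (pdC d j f) := by
  have h : Differentiable ℝ (fderiv ℝ f) :=
    (hf.fderiv_right (m := 1) (by norm_num)).differentiable one_ne_zero
  exact fun x => (h x).clm_apply (differentiableAt_const _)

lemma lapC_gaugePhase_mul (d : ℕ) (w b : EuclideanSpace ℝ (Fin d)) (c : ℝ)
    {f : EuclideanSpace ℝ (Fin d) → ℂ} (hf : ContDiff ℝ 2 f) (x : EuclideanSpace ℝ (Fin d)) :
    lapC d (fun y => gaugePhase d w c y * f (y + b)) x =
      gaugePhase d w c x * (lapC d f (x + b)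
        - Complex.I * ∑ j, (w j : ℂ) * pdC d j f (x + b)
        - (1 / 4) * ((‖w‖ ^ 2 : ℝ) : ℂ) * f (x + b)) := by
  have hd : Differentiable ℝ f := hf.differentiable two_ne_zero
  have key : ∀ j, pdC d j (fun y => pdC d j (fun y => gaugePhase d w c y * f (y + b)) y) x =
      gaugePhase d w c x * (pdC d j (fun y => pdC d j f y) (x + b)
        - Complex.I * ((w j : ℂ) * pdC d j f (x + b))
        - (1 / 4) * (((w j) ^ 2 : ℝ) : ℂ) * f (x + b)) := by
    intro j
    have hp := differentiable_pdC hf j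
    have hq : Differentiable ℝ fun z => pdC d j f z - Complex.I * ((w j / 2 : ℝ) : ℂ) * f z :=
      hp.sub (hd.const_mul _)
    have hg : pdC d j (fun z => pdC d j f z - Complex.I * ((w j / 2 : ℝ) : ℂ) * f z) (x + b) =
        pdC d j (fun z => pdC d j f z) (x + b)
          - Complex.I * ((w j / 2 : ℝ) : ℂ) * pdC d j f (x + b) :=
      (hasDerivAt_line j _ (hq (x + b))).unique
        ((hasDerivAt_line j _ (hp (x + b))).sub ((hasDerivAt_line j _ (hd (x + b))).const_mul _))
    simp only [pdC_gaugePhase_mul d w b c j hd]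
    rw [pdC_gaugePhase_mul d w b c j hq, hg]
    push_cast
    linear_combination gaugePhase d w c x * ((w j : ℂ) ^ 2 / 4 * f (x + b)) * Complex.I_sq
  rw [lapC, Finset.sum_congr rfl fun j _ => key j, ← Finset.mul_sum, lapC,
    Finset.sum_sub_distrib, Finset.sum_sub_distrib, ← Finset.mul_sum, ← Finset.sum_mul,
    ← Finset.mul_sum, EuclideanSpace.real_norm_sq_eq, Complex.ofReal_sum]

lemma hasDerivAt_translate {d : ℕ} {ψ : ℝ → EuclideanSpace ℝ (Fin d) → ℂ}
    (hψ : Differentiable ℝ (Function.uncurry ψ)) {a : ℝ → EuclideanSpace ℝ (Fin d)}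
    (ha : Differentiable ℝ a) (t : ℝ) (x : EuclideanSpace ℝ (Fin d)) :
    HasDerivAt (fun τ => ψ τ (x + a τ)) (deriv (fun τ => ψ τ (x + a t)) t
      + ∑ j, ((deriv a t j : ℝ) : ℂ) * pdC d j (ψ t) (x + a t)) t := by
  have h := (hψ (t, x + a t)).hasFDerivAt
  set L := fderiv ℝ (Function.uncurry ψ) (t, x + a t)
  have h1 : HasDerivAt (fun τ => ψ τ (x + a t)) (L (1, 0)) t :=
    HasFDerivAt.comp_hasDerivAt (f := fun τ => (τ, x + a t)) t h
      ((hasDerivAt_id t).prodMk (hasDerivAt_const t (x + a t)))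
  have h2 : HasFDerivAt (ψ t) (L.comp (ContinuousLinearMap.inr ℝ ℝ _)) (x + a t) :=
    h.comp (x + a t) (hasFDerivAt_prodMk_right t (x + a t))
  have h3 : HasDerivAt (fun τ => ψ τ (x + a τ)) (L (1, deriv a t)) t :=
    HasFDerivAt.comp_hasDerivAt (f := fun τ => (τ, x + a τ)) t h
      ((hasDerivAt_id t).prodMk ((ha t).hasDerivAt.const_add x))
  convert h3 using 1
  have e : ((1 : ℝ), deriv a t) = (1, 0) + ContinuousLinearMap.inr ℝ ℝ _ (deriv a t) := by simp
  rw [e, map_add, h1.deriv]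
  congr 1
  have := continuousLinearMap_apply_eq_sum (L.comp (ContinuousLinearMap.inr ℝ ℝ _)) (deriv a t)
  rw [ContinuousLinearMap.comp_apply] at this
  rw [this]
  simp only [pdC, h2.fderiv, Complex.real_smul]

lemma hasDerivAt_gaugePhase {d : ℕ} {v : ℝ → EuclideanSpace ℝ (Fin d)} {γ : ℝ → ℝ}
    (hv : Differentiable ℝ v) (hγ : Differentiable ℝ γ) (t : ℝ)
    (x : EuclideanSpace ℝ (Fin d)) :
    HasDerivAt (fun τ => gaugePhase d (v τ) (γ τ) x) (gaugePhase d (v t) (γ t) x *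
      (-Complex.I * (((1 / 2) * ∑ j, deriv v t j * x j + deriv γ t : ℝ) : ℂ))) t := by
  have hj : ∀ j, HasDerivAt (fun τ => v τ j) (deriv v t j) t := fun j =>
    (EuclideanSpace.proj (𝕜 := ℝ) j).hasFDerivAt.comp_hasDerivAt t (hv t).hasDerivAt
  have h : HasDerivAt (fun τ => (1 / 2) * ∑ j, v τ j * x j + γ τ)
      ((1 / 2) * ∑ j, deriv v t j * x j + deriv γ t) t :=
    ((HasDerivAt.fun_sum fun j _ => (hj j).mul_const (x j)).const_mul (1 / 2)).add
      (hγ t).hasDerivAt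
  exact (h.ofReal_comp.const_mul (-Complex.I)).cexp

/-- Equation of motion in the moving frame (power nonlinearity): if `ψ` solves
`i∂_tψ = (-Δ + V)ψ - λ|ψ|^{2s}ψ` pointwise then `u = mvFrame a v γ ψ` satisfies
`∂_t u = -i(-Δu + μu - λ|u|^{2s}u) + (ȧ - v)·∇u - i((1/2)v̇ + ∇V(a))·x u
 + i(μ - (1/4)|v|² + (1/2)ȧ·v - V(a) - γ̇)u - i R_V u`. -/
theorem equation_of_motion_moving_frame
    (d : ℕ) (hd : 1 ≤ d) (s lam : ℝ) (hs : 0 < s)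
    (V : EuclideanSpace ℝ (Fin d) → ℝ) (hV : Differentiable ℝ V)
    (a v : ℝ → EuclideanSpace ℝ (Fin d)) (γ : ℝ → ℝ) (μ : ℝ → ℝ)
    (ha : Differentiable ℝ a) (hv : Differentiable ℝ v) (hγ : Differentiable ℝ γ)
    (ψ : ℝ → EuclideanSpace ℝ (Fin d) → ℂ)
    (hψ : ContDiff ℝ (⊤ : ℕ∞) (Function.uncurry ψ))
    (heq : ∀ t x, Complex.I * deriv (fun τ => ψ τ x) t =
      -(lapC d (ψ t) x) + (V x : ℂ) * ψ t x -
        (lam : ℂ) * ((‖ψ t x‖ ^ (2 * s) : ℝ) : ℂ) * ψ t x) :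
    ∀ t x,
      deriv (fun τ => mvFrame d a v γ ψ τ x) t =
        -Complex.I * (-(lapC d (mvFrame d a v γ ψ t) x)
            + ((μ t : ℝ) : ℂ) * mvFrame d a v γ ψ t x
            - (lam : ℂ) * ((‖mvFrame d a v γ ψ t x‖ ^ (2 * s) : ℝ) : ℂ) *
                mvFrame d a v γ ψ t x)
        + (∑ j : Fin d, (((deriv a t) j - (v t) j : ℝ) : ℂ) * pdC d j (mvFrame d a v γ ψ t) x)
        - Complex.I * ((∑ j : Fin d, ((1 / 2) * (deriv v t) j
              + fderiv ℝ V (a t) (EuclideanSpace.single j (1 : ℝ))) * x j : ℝ) : ℂ) *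
            mvFrame d a v γ ψ t x
        + Complex.I * ((μ t - (1 / 4) * ‖v t‖ ^ 2
              + (1 / 2) * ∑ j : Fin d, (deriv a t) j * (v t) j
              - V (a t) - deriv γ t : ℝ) : ℂ) * mvFrame d a v γ ψ t x
        - Complex.I * ((V (x + a t) - V (a t) - fderiv ℝ V (a t) x : ℝ) : ℂ) *
            mvFrame d a v γ ψ t x := by
  intro t x
  have hψt : ContDiff ℝ 2 (ψ t) :=
    (contDiff_infty.1 hψ 2).comp (contDiff_prodMk_right t)
  have hu : mvFrame d a v γ ψ t = fun y => gaugePhase d (v t) (γ t) y * ψ t (y + a t) := rfl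
  have hD := ((hasDerivAt_gaugePhase hv hγ t x).mul
      (hasDerivAt_translate (hψ.differentiable (by simp)) ha t x)).deriv
  change deriv (fun τ => mvFrame d a v γ ψ τ x) t = _ at hD
  have hn : ‖mvFrame d a v γ ψ t x‖ = ‖ψ t (x + a t)‖ := by
    rw [hu, norm_mul, norm_gaugePhase, one_mul]
  have hV' : ∑ j : Fin d, ((1 / 2) * (deriv v t) j
      + fderiv ℝ V (a t) (EuclideanSpace.single j (1 : ℝ))) * x j =
      (1 / 2) * ∑ j, deriv v t j * x j + fderiv ℝ V (a t) x := by
    rw [continuousLinearMap_apply_eq_sum (fderiv ℝ V (a t)) x, Finset.mul_sum,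
      ← Finset.sum_add_distrib]
    exact Finset.sum_congr rfl fun j _ => by rw [smul_eq_mul]; ring
  have hG : ∑ j : Fin d, (((deriv a t) j - (v t) j : ℝ) : ℂ) * pdC d j (mvFrame d a v γ ψ t) x =
      gaugePhase d (v t) (γ t) x * (∑ j, ((deriv a t j : ℝ) : ℂ) * pdC d j (ψ t) (x + a t)
        - ∑ j, ((v t j : ℝ) : ℂ) * pdC d j (ψ t) (x + a t)
        - Complex.I / 2 * ((∑ j, deriv a t j * v t j - ‖v t‖ ^ 2 : ℝ) : ℂ) * ψ t (x + a t)) := by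
    rw [hu, EuclideanSpace.real_norm_sq_eq]
    simp only [pdC_gaugePhase_mul d (v t) (a t) (γ t) _ (hψt.differentiable two_ne_zero)]
    rw [← Finset.sum_sub_distrib, ← Finset.sum_sub_distrib, Complex.ofReal_sum, Finset.mul_sum,
      Finset.sum_mul, ← Finset.sum_sub_distrib, Finset.mul_sum]
    refine Finset.sum_congr rfl fun j _ => ?_
    push_cast
    ring
  have hS := heq t (x + a t)
  rw [hD, hV', hG, hn, hu, lapC_gaugePhase_mul d (v t) (a t) (γ t) hψt]
  simp only [Complex.ofReal_add, Complex.ofReal_sub, Complex.ofReal_mul]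
  set P := gaugePhase d (v t) (γ t) x
  push_cast
  linear_combination (-Complex.I * P) * hS + P * (deriv (fun τ => ψ τ (x + a t)) t
    + ∑ j, ((v t j : ℝ) : ℂ) * pdC d j (ψ t) (x + a t)) * Complex.I_sq
end
end

section
/- Matrix of the restricted symplectic form (Lemma 4.1): Let d ≥ 1 and let η, ζ : ℝ^d → ℝ be Schwartz functions that are radial (each depends only on |x|). Set m := (1/2)∫η² dx and m' := ∫ηζ dx. Define the 2d+2 complex-valued functions z_j := −∂_{x_j}η (j = 1,…,d), z_{d+j} := i x_j η (j = 1,…,d), z_{2d+1} := iη, z_{2d+2} := ζ, and the (2d+2)×(2d+2) real matrix Ω with entries Ω_{jk} := Im ∫_{ℝ^d} z_j(x) conj(z_k(x)) dx. Then Ω equals the block matrix [[0, −m·I_d, 0, 0], [m·I_d, 0, 0, 0], [0, 0, 0, m'], [0, 0, −m', 0]] (blocks of sizes d, d, 1, 1). Moreover, if m ≠ 0 and m' ≠ 0 then Ω is invertible. -/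
open MeasureTheory

noncomputable section

open scoped SchwartzMap LineDeriv

namespace SchwartzMap

variable {E : Type*} [NormedAddCommGroup E] [InnerProductSpace ℝ E] [FiniteDimensional ℝ E]
  [MeasurableSpace E] [BorelSpace E]

/-- The product of two real Schwartz functions is integrable. -/
theorem integrable_mul (f g : 𝓢(E, ℝ)) : Integrable fun x => f x * g x :=
  f.integrable.mul_bdd g.continuous.aestronglyMeasurable
    (.of_forall fun x => g.norm_le_seminorm ℝ x)

/-- A Schwartz function is orthogonal to its directional derivatives. -/
theorem integral_fderiv_mul_self (f : 𝓢(E, ℝ)) (v : E) :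
    ∫ x, fderiv ℝ f x v * f x = 0 := by
  have h := integral_mul_lineDerivOp_right_eq_neg_left (μ := volume) f f v
  simp only [lineDerivOp_apply_eq_fderiv, mul_comm (f _)] at h
  linarith

/-- Integration by parts of a directional derivative against a linear weight. -/
theorem integral_fderiv_mul_clm_mul_self (f : 𝓢(E, ℝ)) (L : E →L[ℝ] ℝ) (v : E) :
    ∫ x, fderiv ℝ f x v * (L x * f x) = -(1 / 2 * L v * ∫ x, f x ^ 2) := by
  set g : 𝓢(E, ℝ) := smulLeftCLM ℝ L f with hg
  have hgx (x : E) : g x = L x * f x := by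
    rw [hg, smulLeftCLM_apply_apply L.hasTemperateGrowth, smul_eq_mul]
  have hdg (x : E) : fderiv ℝ g x v = L v * f x + L x * fderiv ℝ f x v := by
    have : HasFDerivAt g (L x • fderiv ℝ f x + f x • L) x := by
      rw [show (g : E → ℝ) = fun x => L x * f x from funext hgx]
      exact L.hasFDerivAt.mul f.differentiableAt.hasFDerivAt
    rw [this.fderiv]
    simp
    ring
  have h := integral_mul_lineDerivOp_right_eq_neg_left (μ := volume) f g v
  simp only [lineDerivOp_apply_eq_fderiv] at h
  have hint : Integrable fun x => fderiv ℝ f x v * g x := by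
    simpa only [lineDerivOp_apply_eq_fderiv] using integrable_mul (∂_{v} f) g
  have hint' : Integrable fun x => L v * f x ^ 2 := by
    simpa only [sq] using (integrable_mul f f).const_mul (L v)
  have hsplit : (fun x => f x * fderiv ℝ g x v) =
      fun x => L v * f x ^ 2 + fderiv ℝ f x v * g x := by
    ext x
    rw [hdg, hgx]
    ring
  rw [hsplit, integral_add hint' hint, integral_const_mul] at h
  simp only [← hgx]
  linarith

end SchwartzMap

/-- The integral of an odd function vanishes. -/
theorem MeasureTheory.integral_eq_zero_of_odd {E : Type*} [NormedAddCommGroup E]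
    [InnerProductSpace ℝ E] [FiniteDimensional ℝ E] [MeasurableSpace E] [BorelSpace E]
    {f : E → ℝ} (hf : ∀ x, f (-x) = -f x) : ∫ x, f x = 0 := by
  have h := integral_neg_eq_self f volume
  simp only [hf, integral_neg] at h
  linarith

section ImaginaryPart

variable {α : Type*} [MeasurableSpace α] (μ : Measure α) (a b : α → ℝ)

theorem im_integral_ofReal_mul_conj_ofReal :
    (∫ x, (a x : ℂ) * (starRingEnd ℂ) (b x : ℂ) ∂μ).im = 0 := by
  simp only [Complex.conj_ofReal, ← Complex.ofReal_mul, integral_complex_ofReal, Complex.ofReal_im]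

theorem im_integral_I_mul_mul_conj_I_mul :
    (∫ x, (Complex.I * (a x : ℂ)) * (starRingEnd ℂ) (Complex.I * (b x : ℂ)) ∂μ).im = 0 := by
  rw [← im_integral_ofReal_mul_conj_ofReal μ a b]
  congr 2 with x
  simp only [map_mul, Complex.conj_I]
  linear_combination (-(a x : ℂ) * (starRingEnd ℂ) (b x : ℂ)) * Complex.I_mul_I

theorem im_integral_I_mul_mul_conj_ofReal :
    (∫ x, (Complex.I * (a x : ℂ)) * (starRingEnd ℂ) (b x : ℂ) ∂μ).im = ∫ x, a x * b x ∂μ := by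
  simp only [Complex.conj_ofReal, mul_assoc, ← Complex.ofReal_mul, integral_const_mul,
    integral_complex_ofReal, Complex.I_mul_im, Complex.ofReal_re]

theorem im_integral_ofReal_mul_conj_I_mul :
    (∫ x, (a x : ℂ) * (starRingEnd ℂ) (Complex.I * (b x : ℂ)) ∂μ).im = -∫ x, b x * a x ∂μ := by
  rw [← im_integral_I_mul_mul_conj_ofReal, ← Complex.conj_im, ← integral_conj]
  congr 2 with x
  simp only [map_mul, Complex.conj_ofReal]
  ring

end ImaginaryPart

/-- A square matrix over a field is invertible if for every column `i` some row has `i` as its only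
nonzero entry. -/
theorem Matrix.isUnit_of_forall_exists_row {n K : Type*} [Fintype n] [DecidableEq n] [Field K]
    {A : Matrix n n K} (h : ∀ i, ∃ r, A r i ≠ 0 ∧ ∀ k, k ≠ i → A r k = 0) : IsUnit A := by
  rw [← Matrix.mulVec_injective_iff_isUnit, ← Matrix.coe_mulVecLin, ← LinearMap.ker_eq_bot,
    Matrix.ker_mulVecLin_eq_bot_iff]
  intro v hv
  ext i
  obtain ⟨r, hri, hr⟩ := h i
  have hvr := congrFun hv r
  rw [Matrix.mulVec, dotProduct, Finset.sum_eq_single i (fun k _ hk => by simp [hr k hk])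
    (by simp)] at hvr
  exact (mul_eq_zero.mp hvr).resolve_left hri

/-- Matrix of the restricted symplectic form (Lemma 4.1): for radial Schwartz `η, ζ`,
the matrix `Ω_{jk} = Im ∫ z_j conj(z_k)` of the tangent vectors
`z = (-∂_{x_j}η, i x_j η, iη, ζ)` equals the block matrix
`[[0, -m I], [m I, 0]] ⊕ [[0, m'], [-m', 0]]`, and it is invertible when `m ≠ 0 ≠ m'`. -/
theorem matrix_of_restricted_symplectic_form
    (d : ℕ) (hd : 1 ≤ d)
    (η ζ : SchwartzMap (EuclideanSpace ℝ (Fin d)) ℝ)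
    (hη_rad : ∀ x y : EuclideanSpace ℝ (Fin d), ‖x‖ = ‖y‖ → η x = η y)
    (hζ_rad : ∀ x y : EuclideanSpace ℝ (Fin d), ‖x‖ = ‖y‖ → ζ x = ζ y)
    (m m' : ℝ)
    (hm : m = (1 / 2) * ∫ x : EuclideanSpace ℝ (Fin d), (η x) ^ 2)
    (hm' : m' = ∫ x : EuclideanSpace ℝ (Fin d), η x * ζ x)
    (z : Fin (2 * d + 2) → EuclideanSpace ℝ (Fin d) → ℂ)
    (hz : ∀ i : Fin (2 * d + 2),
      z i = if h : (i : ℕ) < d then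
              (fun x => -((fderiv ℝ (⇑η) x (EuclideanSpace.single ⟨(i : ℕ), h⟩ (1 : ℝ)) : ℝ) : ℂ))
            else if h2 : (i : ℕ) < 2 * d then
              (fun x => Complex.I * ((x ⟨(i : ℕ) - d, by omega⟩ : ℝ) : ℂ) * ((η x : ℝ) : ℂ))
            else if (i : ℕ) = 2 * d then (fun x => Complex.I * ((η x : ℝ) : ℂ))
            else (fun x => ((ζ x : ℝ) : ℂ)))
    (Ω : Matrix (Fin (2 * d + 2)) (Fin (2 * d + 2)) ℝ)
    (hΩ : ∀ j k, Ω j k = (∫ x : EuclideanSpace ℝ (Fin d), z j x * (starRingEnd ℂ) (z k x)).im) :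
    (∀ j k : Fin (2 * d + 2),
      Ω j k =
        if (j : ℕ) < d ∧ (k : ℕ) = (j : ℕ) + d then -m
        else if (k : ℕ) < d ∧ (j : ℕ) = (k : ℕ) + d then m
        else if (j : ℕ) = 2 * d ∧ (k : ℕ) = 2 * d + 1 then m'
        else if (j : ℕ) = 2 * d + 1 ∧ (k : ℕ) = 2 * d then -m'
        else 0) ∧
    (m ≠ 0 → m' ≠ 0 → IsUnit Ω) := by
  have hcases (i : Fin (2 * d + 2)) :
      (∃ p : Fin d, (i : ℕ) = p ∧
        z i = fun x => ((-fderiv ℝ η x (EuclideanSpace.single p 1) : ℝ) : ℂ)) ∨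
      (∃ p : Fin d, (i : ℕ) = p + d ∧ z i = fun x => Complex.I * ((x p * η x : ℝ) : ℂ)) ∨
      ((i : ℕ) = 2 * d ∧ z i = fun x => Complex.I * ((η x : ℝ) : ℂ)) ∨
      ((i : ℕ) = 2 * d + 1 ∧ z i = fun x => ((ζ x : ℝ) : ℂ)) := by
    rw [hz i]
    by_cases h1 : (i : ℕ) < d
    · refine .inl ⟨⟨i, h1⟩, rfl, ?_⟩
      simp [h1]
    by_cases h2 : (i : ℕ) < 2 * d
    · refine .inr (.inl ⟨⟨i - d, by omega⟩, by simp only; omega, ?_⟩)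
      simp [h1, h2, mul_assoc]
    by_cases h3 : (i : ℕ) = 2 * d
    · refine .inr (.inr (.inl ⟨h3, ?_⟩))
      rw [dif_neg h1, dif_neg h2, if_pos h3]
    · refine .inr (.inr (.inr ⟨by omega, ?_⟩))
      rw [dif_neg h1, dif_neg h2, if_neg h3]
  have hxη (p q : Fin d) :
      ∫ x : EuclideanSpace ℝ (Fin d), x p * η x * -fderiv ℝ η x (EuclideanSpace.single q 1) =
        if p = q then m else 0 := by
    have h := η.integral_fderiv_mul_clm_mul_self (EuclideanSpace.proj p)
      (EuclideanSpace.single q (1 : ℝ))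
    have hL (x : EuclideanSpace ℝ (Fin d)) :
        (EuclideanSpace.proj p : EuclideanSpace ℝ (Fin d) →L[ℝ] ℝ) x = x p := rfl
    simp only [hL, PiLp.single_apply] at h
    simp only [mul_neg, integral_neg]
    simp only [mul_comm (_ * η _), h, hm]
    split_ifs <;> simp
  have hηη (p : Fin d) :
      ∫ x : EuclideanSpace ℝ (Fin d), η x * -fderiv ℝ η x (EuclideanSpace.single p 1) = 0 := by
    have h := η.integral_fderiv_mul_self (EuclideanSpace.single p (1 : ℝ))
    simp only [mul_neg, integral_neg, mul_comm (η _) (fderiv _ _ _ _), h, neg_zero]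
  have hxηζ (p : Fin d) : ∫ x : EuclideanSpace ℝ (Fin d), x p * η x * ζ x = 0 := by
    refine integral_eq_zero_of_odd fun x => ?_
    rw [hη_rad _ x (norm_neg x), hζ_rad _ x (norm_neg x), PiLp.neg_apply]
    ring
  have hentry (j k : Fin (2 * d + 2)) :
      Ω j k =
        if (j : ℕ) < d ∧ (k : ℕ) = (j : ℕ) + d then -m
        else if (k : ℕ) < d ∧ (j : ℕ) = (k : ℕ) + d then m
        else if (j : ℕ) = 2 * d ∧ (k : ℕ) = 2 * d + 1 then m'
        else if (j : ℕ) = 2 * d + 1 ∧ (k : ℕ) = 2 * d then -m'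
        else 0 := by
    rw [hΩ]
    rcases hcases j with ⟨p, hj, ej⟩ | ⟨p, hj, ej⟩ | ⟨hj, ej⟩ | ⟨hj, ej⟩ <;>
    rcases hcases k with ⟨q, hk, ek⟩ | ⟨q, hk, ek⟩ | ⟨hk, ek⟩ | ⟨hk, ek⟩ <;>
    simp only [ej, ek, im_integral_ofReal_mul_conj_ofReal, im_integral_I_mul_mul_conj_I_mul,
      im_integral_I_mul_mul_conj_ofReal, im_integral_ofReal_mul_conj_I_mul, hxη, hηη, hxηζ, ← hm',
      Fin.ext_iff] <;>
    split_ifs <;> first | omega | simp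
  refine ⟨hentry, fun hm0 hm0' => Matrix.isUnit_of_forall_exists_row fun i => ?_⟩
  obtain ⟨r, hr, hir⟩ : ∃ r < 2 * d + 2,
      ((i : ℕ) < d ∧ r = i + d) ∨ (r < d ∧ (i : ℕ) = r + d) ∨
      ((i : ℕ) = 2 * d ∧ r = 2 * d + 1) ∨ ((i : ℕ) = 2 * d + 1 ∧ r = 2 * d) := by
    rcases hcases i with ⟨p, hi, -⟩ | ⟨p, hi, -⟩ | ⟨hi, -⟩ | ⟨hi, -⟩
    · exact ⟨i + d, by omega⟩
    · exact ⟨p, by omega⟩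
    · exact ⟨2 * d + 1, by omega⟩
    · exact ⟨2 * d, by omega⟩
  refine ⟨⟨r, hr⟩, ?_, fun k hk => ?_⟩
  · rw [hentry]
    dsimp only
    split_ifs <;> first | omega | simpa
  · rw [Ne, Fin.ext_iff] at hk
    rw [hentry]
    dsimp only
    split_ifs <;> first | omega | rfl
end
end

section
/- Nondegeneracy of the restricted symplectic form (Corollary 4.2): Let d ≥ 1 and let η, ζ : ℝ^d → ℝ be radial Schwartz functions with m := (1/2)∫η² dx ≠ 0 and m' := ∫ηζ dx ≠ 0. Define z_j := −∂_{x_j}η (j = 1,…,d), z_{d+j} := i x_j η (j = 1,…,d), z_{2d+1} := iη, z_{2d+2} := ζ, viewed as elements of L²(ℝ^d, ℂ). Then z_1,…,z_{2d+2} are linearly independent over ℝ, and for every nonzero z in the real linear span of {z_1,…,z_{2d+2}} there exists z' in that span with Im ∫_{ℝ^d} z(x) conj(z'(x)) dx ≠ 0. -/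
open MeasureTheory

noncomputable section

open scoped SchwartzMap LineDeriv

section Pairing

variable {E : Type*} [NormedAddCommGroup E] [NormedSpace ℝ E]

/-- The complex-valued function with real part `a` and imaginary part `b`. -/
def complexOfSchwartz (a b : 𝓢(E, ℝ)) : E → ℂ :=
  fun x => (a x : ℂ) + Complex.I * (b x : ℂ)

lemma complexOfSchwartz_mul_conj (a b a' b' : 𝓢(E, ℝ)) (x : E) :
    complexOfSchwartz a b x * (starRingEnd ℂ) (complexOfSchwartz a' b' x) =
      ((a x * a' x + b x * b' x : ℝ) : ℂ) + ((b x * a' x - a x * b' x : ℝ) : ℂ) * Complex.I := by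
  apply Complex.ext
  · simp [complexOfSchwartz]
  · simp [complexOfSchwartz, sub_eq_neg_add]

/-- The symplectic form `Im ∫ u conj v`. -/
def symplecticPairing [MeasureSpace E] (u v : E → ℂ) : ℝ :=
  (∫ x, u x * (starRingEnd ℂ) (v x)).im

variable [FiniteDimensional ℝ E] [MeasureSpace E] [BorelSpace E]
  [(volume : Measure E).IsAddHaarMeasure]

lemma SchwartzMap.integrable_mul_s10 (f g : 𝓢(E, ℝ)) : Integrable fun x => f x * g x :=
  (SchwartzMap.pairing (ContinuousLinearMap.mul ℝ ℝ) f g).integrable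

lemma integrable_complexOfSchwartz_mul_conj (a b a' b' : 𝓢(E, ℝ)) :
    Integrable fun x =>
      complexOfSchwartz a b x * (starRingEnd ℂ) (complexOfSchwartz a' b' x) := by
  simp only [complexOfSchwartz_mul_conj]
  exact ((a.integrable_mul_s10 a').add (b.integrable_mul_s10 b')).ofReal.add
    (((b.integrable_mul_s10 a').sub (a.integrable_mul_s10 b')).ofReal.mul_const _)

lemma symplecticPairing_complexOfSchwartz (a b a' b' : 𝓢(E, ℝ)) :
    symplecticPairing (complexOfSchwartz a b) (complexOfSchwartz a' b') =
      (∫ x, b x * a' x) - ∫ x, a x * b' x := by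
  have him := integral_im (integrable_complexOfSchwartz_mul_conj a b a' b')
  simp only [RCLike.im_to_complex] at him
  rw [symplecticPairing, ← him, ← integral_sub (b.integrable_mul_s10 a') (a.integrable_mul_s10 b')]
  exact integral_congr_ae (.of_forall fun x => by simp [complexOfSchwartz_mul_conj])

end Pairing

lemma symplecticPairing_sum_smul {E ι : Type*} [MeasureSpace E] [Fintype ι] (z : ι → E → ℂ)
    (c : ι → ℝ) (v : E → ℂ) (hzint : ∀ i, Integrable fun x => z i x * (starRingEnd ℂ) (v x)) :
    symplecticPairing (∑ i, c i • z i) v = ∑ i, c i * symplecticPairing (z i) v := by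
  have h : (fun x => (∑ i, c i • z i) x * (starRingEnd ℂ) (v x)) =
      fun x => ∑ i, c i • (z i x * (starRingEnd ℂ) (v x)) := by
    funext x
    simp [Finset.sum_apply, Finset.sum_mul, mul_assoc]
  have hzint' : ∀ i ∈ Finset.univ, Integrable fun x => c i • (z i x * (starRingEnd ℂ) (v x)) :=
    fun i _ => (hzint i).smul (c i)
  rw [symplecticPairing, h, integral_finsetSum _ hzint', Complex.im_sum]
  exact Finset.sum_congr rfl fun i _ => by rw [integral_smul, Complex.smul_im]; rfl

/-- A finite family whose symplectic Gram matrix is a generalized permutation matrix is linearly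
independent, and the symplectic form is nondegenerate on its span. -/
lemma linearIndependent_and_nondegenerate_of_dual {E ι : Type*} [MeasureSpace E] [Fintype ι]
    (z : ι → E → ℂ)
    (hzint : ∀ i j, Integrable fun x => z i x * (starRingEnd ℂ) (z j x))
    (hdual : ∀ k, ∃ l, symplecticPairing (z k) (z l) ≠ 0 ∧
      ∀ i, i ≠ k → symplecticPairing (z i) (z l) = 0) :
    LinearIndependent ℝ z ∧
    ∀ w ∈ Submodule.span ℝ (Set.range z), w ≠ 0 →
      ∃ w' ∈ Submodule.span ℝ (Set.range z),
        (∫ x, w x * (starRingEnd ℂ) (w' x)).im ≠ 0 := by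
  have key : ∀ c : ι → ℝ, ∀ k, ∃ l, symplecticPairing (z k) (z l) ≠ 0 ∧
      symplecticPairing (∑ i, c i • z i) (z l) = c k * symplecticPairing (z k) (z l) := by
    intro c k
    obtain ⟨l, hl, h0⟩ := hdual k
    refine ⟨l, hl, ?_⟩
    rw [symplecticPairing_sum_smul z c _ fun i => hzint i l]
    exact Finset.sum_eq_single k (fun i _ hi => by rw [h0 i hi, mul_zero])
      fun hk => absurd (Finset.mem_univ k) hk
  refine ⟨Fintype.linearIndependent_iff.2 fun c hc k => ?_, fun w hw hne => ?_⟩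
  · obtain ⟨l, hl, h⟩ := key c k
    rw [hc] at h
    have h0 : symplecticPairing (0 : E → ℂ) (z l) = 0 := by simp [symplecticPairing]
    exact (mul_eq_zero.1 (h.symm.trans h0)).resolve_right hl
  · obtain ⟨c, rfl⟩ := (Submodule.mem_span_range_iff_exists_fun ℝ).1 hw
    obtain ⟨k, hk⟩ : ∃ k, c k ≠ 0 := by
      by_contra! h
      exact hne (by simp [h])
    obtain ⟨l, hl, h⟩ := key c k
    refine ⟨z l, Submodule.subset_span ⟨l, rfl⟩, ?_⟩
    change symplecticPairing _ _ ≠ 0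
    rw [h]
    exact mul_ne_zero hk hl

section Integrals

variable {d : ℕ}

lemma hasTemperateGrowth_coord (k : Fin d) :
    (fun x : EuclideanSpace ℝ (Fin d) => x k).HasTemperateGrowth :=
  (EuclideanSpace.proj (𝕜 := ℝ) k).hasTemperateGrowth

/-- The Schwartz function `x_k f`. -/
def coordMul (k : Fin d) (f : 𝓢(EuclideanSpace ℝ (Fin d), ℝ)) :
    𝓢(EuclideanSpace ℝ (Fin d), ℝ) :=
  SchwartzMap.smulLeftCLM ℝ (fun x : EuclideanSpace ℝ (Fin d) => x k) f

lemma coordMul_apply (k : Fin d) (f : 𝓢(EuclideanSpace ℝ (Fin d), ℝ))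
    (x : EuclideanSpace ℝ (Fin d)) : coordMul k f x = x k * f x := by
  rw [coordMul, SchwartzMap.smulLeftCLM_apply_apply (hasTemperateGrowth_coord k), smul_eq_mul]

/-- The partial derivative `∂_{x_j} f`. -/
def partialDeriv (j : Fin d) (f : 𝓢(EuclideanSpace ℝ (Fin d), ℝ)) :
    𝓢(EuclideanSpace ℝ (Fin d), ℝ) :=
  ∂_{EuclideanSpace.single j (1 : ℝ)} f

lemma partialDeriv_coordMul_apply (j k : Fin d) (f : 𝓢(EuclideanSpace ℝ (Fin d), ℝ))
    (x : EuclideanSpace ℝ (Fin d)) :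
    partialDeriv j (coordMul k f) x =
      x k * partialDeriv j f x + (if j = k then 1 else 0) * f x := by
  have h1 : HasFDerivAt (fun y : EuclideanSpace ℝ (Fin d) => y k)
      (EuclideanSpace.proj (𝕜 := ℝ) k) x := (EuclideanSpace.proj (𝕜 := ℝ) k).hasFDerivAt
  have h2 := (h1.mul (f.hasFDerivAt x)).fderiv
  have h3 : (coordMul k f : EuclideanSpace ℝ (Fin d) → ℝ) = (fun y => y k) * ⇑f :=
    funext fun y => coordMul_apply k f y
  rw [partialDeriv, SchwartzMap.lineDerivOp_apply_eq_fderiv, h3, h2]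
  simp [partialDeriv, SchwartzMap.lineDerivOp_apply_eq_fderiv, mul_comm, eq_comm]

lemma integral_mul_partialDeriv (j : Fin d) (f g : 𝓢(EuclideanSpace ℝ (Fin d), ℝ)) :
    ∫ x, f x * partialDeriv j g x = -∫ x, partialDeriv j f x * g x :=
  SchwartzMap.integral_mul_lineDerivOp_right_eq_neg_left f g _

lemma integral_mul_partialDeriv_self (j : Fin d) (f : 𝓢(EuclideanSpace ℝ (Fin d), ℝ)) :
    ∫ x, f x * partialDeriv j f x = 0 := by
  have h := integral_mul_partialDeriv j f f
  simp only [mul_comm (partialDeriv j f _)] at h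
  linarith

lemma integral_coordMul_mul_partialDeriv (j k : Fin d) (f : 𝓢(EuclideanSpace ℝ (Fin d), ℝ)) :
    ∫ x, coordMul k f x * partialDeriv j f x =
      -((if j = k then 1 else 0) * ((1 / 2) * ∫ x, f x ^ 2)) := by
  have h := integral_mul_partialDeriv j (coordMul k f) f
  have h' : ∀ x, partialDeriv j (coordMul k f) x * f x =
      coordMul k f x * partialDeriv j f x + (if j = k then 1 else 0) * (f x * f x) := fun x => by
    rw [partialDeriv_coordMul_apply, coordMul_apply]
    ring
  simp only [h'] at h
  rw [integral_add (SchwartzMap.integrable_mul_s10 _ _) ((f.integrable_mul_s10 f).const_mul _),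
    integral_const_mul] at h
  simp only [pow_two]
  linarith

lemma integral_coordMul_mul_of_even (k : Fin d) (f g : 𝓢(EuclideanSpace ℝ (Fin d), ℝ))
    (hf : ∀ x, f (-x) = f x) (hg : ∀ x, g (-x) = g x) :
    ∫ x, coordMul k f x * g x = 0 := by
  have h := integral_neg_eq_self (fun x => coordMul k f x * g x) volume
  simp only [coordMul_apply, hf, hg, PiLp.neg_apply, neg_mul, integral_neg] at h
  simp only [coordMul_apply]
  linarith

end Integrals

/-- Nondegeneracy of the restricted symplectic form (Corollary 4.2): for radial Schwartz
`η, ζ` with `m ≠ 0` and `m' ≠ 0`, the tangent vectors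
`z = (-∂_{x_j}η, i x_j η, iη, ζ)` are linearly independent over `ℝ`, and the symplectic
pairing `Im ∫ z conj(z')` is nondegenerate on their real span. -/
theorem nondegeneracy_of_restricted_symplectic_form
    (d : ℕ) (hd : 1 ≤ d)
    (η ζ : SchwartzMap (EuclideanSpace ℝ (Fin d)) ℝ)
    (hη_rad : ∀ x y : EuclideanSpace ℝ (Fin d), ‖x‖ = ‖y‖ → η x = η y)
    (hζ_rad : ∀ x y : EuclideanSpace ℝ (Fin d), ‖x‖ = ‖y‖ → ζ x = ζ y)
    (hm : (1 / 2) * ∫ x : EuclideanSpace ℝ (Fin d), (η x) ^ 2 ≠ 0)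
    (hm' : (∫ x : EuclideanSpace ℝ (Fin d), η x * ζ x) ≠ 0)
    (z : Fin (2 * d + 2) → EuclideanSpace ℝ (Fin d) → ℂ)
    (hz : ∀ i : Fin (2 * d + 2),
      z i = if h : (i : ℕ) < d then
              (fun x => -((fderiv ℝ (⇑η) x (EuclideanSpace.single ⟨(i : ℕ), h⟩ (1 : ℝ)) : ℝ) : ℂ))
            else if h2 : (i : ℕ) < 2 * d then
              (fun x => Complex.I * ((x ⟨(i : ℕ) - d, by omega⟩ : ℝ) : ℂ) * ((η x : ℝ) : ℂ))
            else if (i : ℕ) = 2 * d then (fun x => Complex.I * ((η x : ℝ) : ℂ))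
            else (fun x => ((ζ x : ℝ) : ℂ))) :
    LinearIndependent ℝ z ∧
    ∀ w ∈ Submodule.span ℝ (Set.range z), w ≠ 0 →
      ∃ w' ∈ Submodule.span ℝ (Set.range z),
        (∫ x : EuclideanSpace ℝ (Fin d), w x * (starRingEnd ℂ) (w' x)).im ≠ 0 := by
  have hη_even : ∀ x, η (-x) = η x := fun x => hη_rad _ _ (norm_neg x)
  have hζ_even : ∀ x, ζ (-x) = ζ x := fun x => hζ_rad _ _ (norm_neg x)
  have hT : ∀ j : Fin d, z ⟨j, by omega⟩ = complexOfSchwartz (-partialDeriv j η) 0 := by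
    intro j
    funext x
    simp [hz, complexOfSchwartz, partialDeriv, SchwartzMap.lineDerivOp_apply_eq_fderiv]
  have hB : ∀ j : Fin d, z ⟨d + j, by omega⟩ = complexOfSchwartz 0 (coordMul j η) := by
    intro j
    funext x
    have h : d + (j : ℕ) < 2 * d := by omega
    simp [hz, complexOfSchwartz, coordMul_apply, h, mul_assoc]
  have hG : z ⟨2 * d, by omega⟩ = complexOfSchwartz 0 η := by
    funext x
    have h : ¬ 2 * d < d := by omega
    simp [hz, complexOfSchwartz, h]
  have hF : z ⟨2 * d + 1, by omega⟩ = complexOfSchwartz ζ 0 := by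
    funext x
    have h : ¬ 2 * d + 1 < d := by omega
    have h' : ¬ 2 * d + 1 < 2 * d := by omega
    simp [hz, complexOfSchwartz, h, h']
  have hcases : ∀ P : Fin (2 * d + 2) → Prop, (∀ j : Fin d, P ⟨j, by omega⟩) →
      (∀ j : Fin d, P ⟨d + j, by omega⟩) → P ⟨2 * d, by omega⟩ → P ⟨2 * d + 1, by omega⟩ →
      ∀ i, P i := by
    intro P h1 h2 h3 h4 ⟨i, hi⟩
    by_cases hi1 : i < d
    · exact h1 ⟨i, hi1⟩
    by_cases hi2 : i < 2 * d
    · have h := h2 ⟨i - d, by omega⟩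
      simpa only [Nat.add_sub_cancel' (not_lt.1 hi1)] using h
    by_cases hi3 : i = 2 * d
    · subst hi3
      exact h3
    · obtain rfl : i = 2 * d + 1 := by omega
      exact h4
  have hrep : ∀ i, ∃ a b, z i = complexOfSchwartz a b :=
    hcases _ (fun j => ⟨_, _, hT j⟩) (fun j => ⟨_, _, hB j⟩) ⟨_, _, hG⟩ ⟨_, _, hF⟩
  have hXD := fun j k => integral_coordMul_mul_partialDeriv j k η
  have hDX : ∀ j k, ∫ x, partialDeriv j η x * coordMul k η x =
      -((if j = k then 1 else 0) * ((1 / 2) * ∫ x, η x ^ 2)) := fun j k => by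
    simpa only [mul_comm] using hXD j k
  have hηD := fun j => integral_mul_partialDeriv_self j η
  have hDη : ∀ j, ∫ x, partialDeriv j η x * η x = 0 := fun j => by
    simpa only [mul_comm] using hηD j
  have hXζ := fun k => integral_coordMul_mul_of_even k η ζ hη_even hζ_even
  have hζX : ∀ k, ∫ x, ζ x * coordMul k η x = 0 := fun k => by
    simpa only [mul_comm] using hXζ k
  have hζη : ∫ x, ζ x * η x ≠ 0 := by simpa only [mul_comm] using hm'
  refine linearIndependent_and_nondegenerate_of_dual z (fun i j => ?_) (hcases _ ?_ ?_ ?_ ?_)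
  · obtain ⟨a, b, hi⟩ := hrep i
    obtain ⟨a', b', hj⟩ := hrep j
    rw [hi, hj]
    exact integrable_complexOfSchwartz_mul_conj a b a' b'
  · intro k
    refine ⟨⟨d + k, by omega⟩, ?_, hcases _ (fun j hj => ?_) (fun j _ => ?_) (fun _ => ?_)
      fun _ => ?_⟩
    · rw [hT, hB, symplecticPairing_complexOfSchwartz]
      simpa [integral_neg, hDX] using hm
    · have hjk : j ≠ k := fun h => hj (by rw [h])
      rw [hT, hB, symplecticPairing_complexOfSchwartz]
      simp [integral_neg, hDX, hjk]
    · rw [hB, hB, symplecticPairing_complexOfSchwartz]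
      simp
    · rw [hG, hB, symplecticPairing_complexOfSchwartz]
      simp
    · rw [hF, hB, symplecticPairing_complexOfSchwartz]
      simp [hζX]
  · intro k
    refine ⟨⟨k, by omega⟩, ?_, hcases _ (fun j _ => ?_) (fun j hj => ?_) (fun _ => ?_)
      fun _ => ?_⟩
    · rw [hT, hB, symplecticPairing_complexOfSchwartz]
      simpa [integral_neg, hXD] using hm
    · rw [hT, hT, symplecticPairing_complexOfSchwartz]
      simp
    · have hjk : k ≠ j := fun h => hj (by rw [h])
      rw [hT, hB, symplecticPairing_complexOfSchwartz]
      simp [integral_neg, hXD, hjk]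
    · rw [hG, hT, symplecticPairing_complexOfSchwartz]
      simp [integral_neg, hηD]
    · rw [hF, hT, symplecticPairing_complexOfSchwartz]
      simp
  · refine ⟨⟨2 * d + 1, by omega⟩, ?_, hcases _ (fun j _ => ?_) (fun j _ => ?_)
      (fun h => absurd rfl h) fun _ => ?_⟩
    · rw [hG, hF, symplecticPairing_complexOfSchwartz]
      simpa using hm'
    · rw [hT, hF, symplecticPairing_complexOfSchwartz]
      simp
    · rw [hB, hF, symplecticPairing_complexOfSchwartz]
      simp [hXζ]
    · rw [hF, symplecticPairing_complexOfSchwartz]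
      simp
  · refine ⟨⟨2 * d, by omega⟩, ?_, hcases _ (fun j _ => ?_) (fun j _ => ?_)
      (fun _ => ?_) fun h => absurd rfl h⟩
    · rw [hG, hF, symplecticPairing_complexOfSchwartz]
      simpa using hζη
    · rw [hT, hG, symplecticPairing_complexOfSchwartz]
      simp [integral_neg, hDη]
    · rw [hB, hG, symplecticPairing_complexOfSchwartz]
      simp
    · rw [hG, symplecticPairing_complexOfSchwartz]
      simp
end
end

section
/- One-dimensional kernel via the Wronskian (Weinstein's theorem, d = 1): Let q : ℝ → ℝ be continuous and let w₁, w₂ : ℝ → ℝ be twice continuously differentiable with w₁'' = q w₁ and w₂'' = q w₂ on ℝ, whose Wronskian satisfies w₁(0)w₂'(0) − w₁'(0)w₂(0) = −1. Assume w₁(x) > 0 for all x > 0 and that there exist constants κ > 0 and 0 < c₁ ≤ C such that c₁ e^{−κx} ≤ w₁(x) ≤ C e^{−κx} for all x ≥ 1. Then w₂(x) → −∞ as x → ∞; consequently, every solution w of w'' = q w on ℝ that is bounded on [0,∞) is a real scalar multiple of w₁. -/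
open Filter

/-- The first two derivatives of a `C²` function on the line. -/
lemma ContDiff.hasDerivAt_two {w : ℝ → ℝ} (hw : ContDiff ℝ 2 w) (x : ℝ) :
    HasDerivAt w (deriv w x) x ∧ HasDerivAt (deriv w) (deriv (deriv w) x) x := by
  refine ⟨((hw.differentiable (by norm_num)) x).hasDerivAt, ?_⟩
  have h : ContDiff ℝ (1 + 1) w := by
    rw [one_add_one_eq_two]
    exact hw
  exact (((contDiff_succ_iff_deriv.1 h).2.2.differentiable (by norm_num)) x).hasDerivAt

/-- The Wronskian of two solutions of `w'' = q w` is constant. -/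
lemma wronskian_eq_of_solutions {q u v : ℝ → ℝ} (hu : ContDiff ℝ 2 u) (hv : ContDiff ℝ 2 v)
    (hqu : ∀ x, deriv (deriv u) x = q x * u x) (hqv : ∀ x, deriv (deriv v) x = q x * v x)
    (x y : ℝ) :
    u x * deriv v x - deriv u x * v x = u y * deriv v y - deriv u y * v y := by
  have h : ∀ t, HasDerivAt (fun t => u t * deriv v t - deriv u t * v t) 0 t := by
    intro t
    obtain ⟨hu₁, hu₂⟩ := hu.hasDerivAt_two t
    obtain ⟨hv₁, hv₂⟩ := hv.hasDerivAt_two t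
    refine ((hu₁.mul hv₂).sub (hu₂.mul hv₁)).congr_deriv ?_
    rw [hqu, hqv]
    ring
  exact is_const_of_deriv_eq_zero (fun t => (h t).differentiableAt) (fun t => (h t).deriv) x y

/-- If `u` is positive with two-sided exponential decay on `[1, ∞)` and the Wronskian of `u, v`
is `-1`, then `v → -∞`. -/
lemma tendsto_atBot_of_wronskian_eq_neg_one {u v : ℝ → ℝ} (hu : Differentiable ℝ u)
    (hv : Differentiable ℝ v) (hW : ∀ x, u x * deriv v x - deriv u x * v x = -1)
    {κ c C : ℝ} (hκ : 0 < κ) (hc : 0 < c) (hcC : c ≤ C)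
    (hdecay : ∀ x ≥ 1, c * Real.exp (-κ * x) ≤ u x ∧ u x ≤ C * Real.exp (-κ * x)) :
    Tendsto v atTop atBot := by
  have hC : 0 < C := hc.trans_le hcC
  have hpos : ∀ x ≥ 1, 0 < u x := fun x hx =>
    (mul_pos hc (Real.exp_pos _)).trans_le (hdecay x hx).1
  set B : ℝ := 1 / (2 * κ * C ^ 2) with hB
  have hB₀ : 0 < B := by positivity
  set g : ℝ → ℝ := fun x => v x / u x + B * Real.exp (2 * κ * x) with hg
  have hderiv : ∀ x ≥ 1, HasDerivAt g (-1 / u x ^ 2 + Real.exp (2 * κ * x) / C ^ 2) x := by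
    intro x hx
    have hne := (hpos x hx).ne'
    have h₁ := (hv x).hasDerivAt.div (hu x).hasDerivAt hne
    have h₂ := ((((hasDerivAt_id x).const_mul (2 * κ)).exp).const_mul B)
    refine (h₁.add h₂).congr_deriv ?_
    have hnum : deriv v x * u x - v x * deriv u x = -1 := by linarith [hW x]
    rw [hnum, hB]
    simp only [id]
    field_simp
  have hanti : AntitoneOn g (Set.Ici 1) := by
    refine antitoneOn_of_deriv_nonpos (convex_Ici 1)
      (fun x hx => (hderiv x hx).continuousAt.continuousWithinAt)
      (fun x hx => (hderiv x (interior_subset hx)).differentiableAt.differentiableWithinAt) ?_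
    intro x hx
    have hx₁ : (1 : ℝ) ≤ x := interior_subset hx
    rw [(hderiv x hx₁).deriv]
    have hu₀ := hpos x hx₁
    have hsq : u x ^ 2 * Real.exp (2 * κ * x) ≤ C ^ 2 := by
      have hexp : Real.exp (-κ * x) ^ 2 * Real.exp (2 * κ * x) = 1 := by
        rw [← Real.exp_nat_mul, ← Real.exp_add, Real.exp_eq_one_iff]
        push_cast
        ring
      calc u x ^ 2 * Real.exp (2 * κ * x)
          ≤ (C * Real.exp (-κ * x)) ^ 2 * Real.exp (2 * κ * x) := by
            gcongr
            exact (hdecay x hx₁).2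
        _ = C ^ 2 := by rw [mul_pow, mul_assoc, hexp, mul_one]
    have hle : Real.exp (2 * κ * x) / C ^ 2 ≤ 1 / u x ^ 2 := by
      rw [div_le_div_iff₀ (by positivity) (by positivity)]
      linarith
    rw [neg_div]
    linarith
  have hbound : ∀ x ≥ 1, v x ≤ C * |g 1| - c * B * Real.exp (κ * x) := by
    intro x hx
    have hu₀ := hpos x hx
    have hgx : g x ≤ |g 1| :=
      (hanti Set.self_mem_Ici hx hx).trans (le_abs_self _)
    have hvx : v x = u x * g x - u x * (B * Real.exp (2 * κ * x)) := by
      simp only [hg]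
      field_simp
      ring
    have huC : u x ≤ C := by
      refine (hdecay x hx).2.trans (mul_le_of_le_one_right hC.le (Real.exp_le_one_iff.2 ?_))
      nlinarith
    have h₁ : u x * g x ≤ C * |g 1| :=
      (mul_le_mul_of_nonneg_left hgx hu₀.le).trans
        (mul_le_mul_of_nonneg_right huC (abs_nonneg _))
    have h₂ : c * B * Real.exp (κ * x) ≤ u x * (B * Real.exp (2 * κ * x)) := by
      have hexp : Real.exp (κ * x) = Real.exp (-κ * x) * Real.exp (2 * κ * x) := by
        rw [← Real.exp_add]
        ring_nf
      calc c * B * Real.exp (κ * x)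
          = c * Real.exp (-κ * x) * (B * Real.exp (2 * κ * x)) := by rw [hexp]; ring
        _ ≤ u x * (B * Real.exp (2 * κ * x)) :=
            mul_le_mul_of_nonneg_right (hdecay x hx).1 (by positivity)
    linarith
  refine tendsto_atBot_mono' atTop ((eventually_ge_atTop 1).mono hbound) ?_
  have hexp : Tendsto (fun x => c * B * Real.exp (κ * x)) atTop atTop :=
    (Real.tendsto_exp_atTop.comp (tendsto_id.const_mul_atTop hκ)).const_mul_atTop
      (mul_pos hc hB₀)
  simpa only [sub_eq_add_neg, Function.comp_apply] using
    tendsto_atBot_add_const_left atTop (C * |g 1|) (tendsto_neg_atTop_atBot.comp hexp)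

/-- One-dimensional kernel via the Wronskian (Weinstein's theorem, d = 1): if `w₁, w₂` solve
`w'' = q w` with Wronskian `-1`, `w₁ > 0` on `(0,∞)` with two-sided exponential decay, then
`w₂ → -∞` at `+∞`; consequently every solution bounded on `[0,∞)` is a multiple of `w₁`. -/
theorem kernel_one_dimensional_via_wronskian
    (q : ℝ → ℝ) (hq : Continuous q)
    (w₁ w₂ : ℝ → ℝ) (hw₁ : ContDiff ℝ 2 w₁) (hw₂ : ContDiff ℝ 2 w₂)
    (heq₁ : ∀ x, deriv (deriv w₁) x = q x * w₁ x)
    (heq₂ : ∀ x, deriv (deriv w₂) x = q x * w₂ x)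
    (hWr : w₁ 0 * deriv w₂ 0 - deriv w₁ 0 * w₂ 0 = -1)
    (hpos : ∀ x > 0, 0 < w₁ x)
    (κ c₁ C : ℝ) (hκ : 0 < κ) (hc₁ : 0 < c₁) (hc₁C : c₁ ≤ C)
    (hdecay : ∀ x ≥ 1, c₁ * Real.exp (-κ * x) ≤ w₁ x ∧ w₁ x ≤ C * Real.exp (-κ * x)) :
    Tendsto w₂ atTop atBot ∧
    ∀ w : ℝ → ℝ, ContDiff ℝ 2 w → (∀ x, deriv (deriv w) x = q x * w x) →
      (∃ M, ∀ x ≥ 0, |w x| ≤ M) → ∃ a : ℝ, ∀ x, w x = a * w₁ x := by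
  have hW : ∀ x, w₁ x * deriv w₂ x - deriv w₁ x * w₂ x = -1 := fun x =>
    (wronskian_eq_of_solutions hw₁ hw₂ heq₁ heq₂ x 0).trans hWr
  have hlim : Tendsto w₂ atTop atBot :=
    tendsto_atBot_of_wronskian_eq_neg_one (hw₁.differentiable (by norm_num))
      (hw₂.differentiable (by norm_num)) hW hκ hc₁ hc₁C hdecay
  refine ⟨hlim, ?_⟩
  rintro w hw heq ⟨M, hM⟩
  set m := w 0 * deriv w₂ 0 - deriv w 0 * w₂ 0
  set k := w₁ 0 * deriv w 0 - deriv w₁ 0 * w 0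
  have hcomb : ∀ x, w x = -m * w₁ x - k * w₂ x := by
    intro x
    have hm : w x * deriv w₂ x - deriv w x * w₂ x = m :=
      wronskian_eq_of_solutions hw hw₂ heq heq₂ x 0
    have hk : w₁ x * deriv w x - deriv w₁ x * w x = k :=
      wronskian_eq_of_solutions hw₁ hw heq₁ heq x 0
    linear_combination -w₁ x * hm - w₂ x * hk + w x * hW x
  have hk₀ : k = 0 := by
    by_contra hk
    have hk' : 0 < |k| := abs_pos.2 hk
    obtain ⟨x, hx, hx₁⟩ := ((hlim.eventually_lt_atBot (-((M + |m| * C) / |k|))).and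
      (eventually_ge_atTop 1)).exists
    have hu₀ := hpos x (by linarith)
    have huC : w₁ x ≤ C := by
      refine (hdecay x hx₁).2.trans
        (mul_le_of_le_one_right (hc₁.le.trans hc₁C) (Real.exp_le_one_iff.2 ?_))
      nlinarith
    have hkw : k * w₂ x = -m * w₁ x - w x := by linarith [hcomb x]
    have hle : |k| * |w₂ x| ≤ M + |m| * C := by
      rw [← abs_mul, hkw]
      calc |-m * w₁ x - w x| ≤ |-m * w₁ x| + |w x| := abs_sub _ _
        _ = |m| * w₁ x + |w x| := by rw [abs_mul, abs_neg, abs_of_pos hu₀]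
        _ ≤ |m| * C + M :=
          add_le_add (mul_le_mul_of_nonneg_left huC (abs_nonneg _)) (hM x (by linarith))
        _ = M + |m| * C := add_comm _ _
    have h₁ : |w₂ x| ≤ (M + |m| * C) / |k| := by
      rw [le_div_iff₀ hk']
      linarith
    linarith [neg_abs_le (w₂ x)]
  refine ⟨-m, fun x => ?_⟩
  rw [hcomb x, hk₀]
  ring
end
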